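/- arXiv:1602.02302 — 4 statements merged into one kernel-verified Lean document; each statement's English description precedes it below -/
import Mathlib

section
/- For every integer r ≥ 3 and every real ε > 0 there exists a positive integer L = L(r,ε) such that every K_r-free graph G on n vertices with minimum degree δ(G) ≥ ((2r-5)/(2r-3) + ε)·n admits a graph homomorphism into some K_r-free graph H on at most L vertices. -/
open Finset Classical in
/-- Number of ordered `k`-cliques inside `S`. -/
noncomputable def cliqueCount {V : Type} (G : SimpleGraph V) : ℕ → Finset V → ℝ
  | 0, _ => 1
  | k + 1, S => ∑ w ∈ S, cliqueCount G k (S.filter (fun x => G.Adj w x))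

section
open Finset Classical
variable {V : Type} (G : SimpleGraph V)

lemma cliqueCount_nonneg (k : ℕ) (S : Finset V) : 0 ≤ cliqueCount G k S := by
  induction k generalizing S with
  | zero => simp [cliqueCount]
  | succ k ih => exact Finset.sum_nonneg fun w _ => ih _

lemma cliqueCount_mono (k : ℕ) {S T : Finset V} (h : S ⊆ T) :
    cliqueCount G k S ≤ cliqueCount G k T := by
  induction k generalizing S T with
  | zero => simp [cliqueCount]
  | succ k ih =>
    calc cliqueCount G (k+1) S ≤ ∑ w ∈ S, cliqueCount G k (T.filter (fun x => G.Adj w x)) :=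
          Finset.sum_le_sum fun w _ => ih (Finset.filter_subset_filter _ h)
      _ ≤ _ := Finset.sum_le_sum_of_subset_of_nonneg h fun _ _ _ => cliqueCount_nonneg G _ _

lemma exists_clique_of_pos (k : ℕ) (S : Finset V) (h : 0 < cliqueCount G k S) :
    ∃ w : Fin k → V, (∀ i, w i ∈ S) ∧ ∀ i j, i ≠ j → G.Adj (w i) (w j) := by
  induction k generalizing S with
  | zero => exact ⟨Fin.elim0, fun i => i.elim0, fun i => i.elim0⟩
  | succ k ih =>
    obtain ⟨w, hw, hw'⟩ : ∃ w ∈ S, 0 < cliqueCount G k (S.filter (fun x => G.Adj w x)) := by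
      by_contra! hc
      exact absurd h (not_lt.2 (Finset.sum_nonpos hc))
    obtain ⟨t, ht, ht'⟩ := ih _ hw'
    simp only [mem_filter] at ht
    refine ⟨Fin.cons w t, ?_, ?_⟩
    · intro i
      refine Fin.cases ?_ ?_ i
      · simpa using hw
      · intro i; simpa using (ht i).1
    · intro i j
      refine Fin.cases ?_ (fun i => ?_) i <;> refine Fin.cases ?_ (fun j => ?_) j
      · simp
      · intro _; simpa using (ht j).2
      · intro _; simpa using (ht i).2.symm
      · intro hij; simpa using ht' i j (by simpa using hij)

lemma cliqueCount_repr [Fintype V] (k : ℕ) : ∃ F : (Fin k → V) → ℝ, (∀ w, 0 ≤ F w ∧ F w ≤ 1) ∧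
    ∀ S, cliqueCount G k S = ∑ w, if (∀ i, w i ∈ S) then F w else 0 := by
  induction k with
  | zero => exact ⟨fun _ => 1, by simp, by simp [cliqueCount]⟩
  | succ k ih =>
    obtain ⟨F, hF, hS⟩ := ih
    refine ⟨fun w => if (∀ i, G.Adj (w 0) (Fin.tail w i)) then F (Fin.tail w) else 0, ?_, ?_⟩
    · intro w; dsimp only; split_ifs
      · exact hF _
      · simp
    · intro S
      rw [cliqueCount, ← (Fin.consEquiv (fun _ => V)).sum_comp, Fintype.sum_prod_type]
      have : ∀ f : V → ℝ, ∑ w ∈ S, f w = ∑ w, if w ∈ S then f w else 0 := by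
        intro f; simp
      rw [this]
      refine Finset.sum_congr rfl fun v _ => ?_
      simp only [Fin.consEquiv_apply, Fin.forall_fin_succ, Fin.cons_zero, Fin.cons_succ,
        hS, mem_filter]
      by_cases hv : v ∈ S
      · simp only [hv, if_true, true_and]
        refine Finset.sum_congr rfl fun t _ => ?_
        rw [← ite_and]
        simp only [forall_and]
        rfl
      · simp [hv]

lemma cliqueCount_le [Fintype V] (k : ℕ) (S : Finset V) :
    cliqueCount G k S ≤ (Fintype.card V : ℝ) ^ k := by
  obtain ⟨F, hF, hS⟩ := cliqueCount_repr G k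
  rw [hS]
  calc _ ≤ ∑ w : Fin k → V, (1:ℝ) := by
        refine Finset.sum_le_sum fun w _ => ?_
        split_ifs
        · exact (hF w).2
        · simp
    _ = _ := by simp

lemma cliqueCount_sdiff [Fintype V] (k : ℕ) (S B : Finset V) (γ : ℝ) (hγ : 0 ≤ γ)
    (hB : (B.card : ℝ) ≤ γ * Fintype.card V) :
    cliqueCount G k S ≤ cliqueCount G k (S \ B) + k * γ * (Fintype.card V : ℝ) ^ k := by
  induction k generalizing S with
  | zero => simp [cliqueCount]
  | succ k ih =>
    set n : ℝ := (Fintype.card V : ℝ) with hn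
    have hn0 : 0 ≤ n := by positivity
    have h1 : cliqueCount G (k+1) S = ∑ w ∈ S \ B, cliqueCount G k (S.filter (fun x => G.Adj w x))
        + ∑ w ∈ S ∩ B, cliqueCount G k (S.filter (fun x => G.Adj w x)) := by
      rw [cliqueCount, ← Finset.sum_sdiff (Finset.inter_subset_left : S ∩ B ⊆ S)]
      simp
    have h2 : ∑ w ∈ S ∩ B, cliqueCount G k (S.filter (fun x => G.Adj w x)) ≤ γ * n * n ^ k := by
      calc _ ≤ ∑ w ∈ S ∩ B, n ^ k := Finset.sum_le_sum fun w _ => cliqueCount_le G _ _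
        _ = (S ∩ B).card * n ^ k := by simp
        _ ≤ _ := by
          gcongr
          refine le_trans ?_ hB
          exact_mod_cast Finset.card_le_card Finset.inter_subset_right
    have h3 : ∑ w ∈ S \ B, cliqueCount G k (S.filter (fun x => G.Adj w x)) ≤
        cliqueCount G (k+1) (S \ B) + n * (k * γ * n ^ k) := by
      calc _ ≤ ∑ w ∈ S \ B, (cliqueCount G k ((S \ B).filter (fun x => G.Adj w x))
              + k * γ * n ^ k) := by
            refine Finset.sum_le_sum fun w _ => ?_
            refine (ih _).trans ?_
            gcongr
            refine cliqueCount_mono G k ?_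
            intro x; simp; tauto
        _ = cliqueCount G (k+1) (S \ B) + (S \ B).card * (k * γ * n ^ k) := by
            rw [Finset.sum_add_distrib]; simp [cliqueCount]
        _ ≤ _ := by
            gcongr
            rw [hn]
            exact_mod_cast Finset.card_le_univ (S \ B)
    rw [h1]; push_cast; rw [pow_succ]
    linarith

/-- Claim B. -/
lemma pairs_lower [Fintype V] {ι : Type} (a : ι → V) (η ε : ℝ) (hε : 0 < ε) (hη : 0 ≤ η)
    (hdeg : ∀ v, ((univ.filter (fun x => ¬ G.Adj v x)).card : ℝ) ≤ (2 * η - ε) * Fintype.card V)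
    (k : ℕ) (J : Finset ι) (hJ : J.card = k + 2) (Z : Finset V)
    (hZ : (2 * k + 1) * η * Fintype.card V ≤ Z.card) :
    (ε * Fintype.card V) ^ k ≤ ∑ p ∈ J.offDiag,
      cliqueCount G k (Z.filter (fun x => G.Adj (a p.1) x ∧ G.Adj (a p.2) x)) := by
  induction k generalizing J Z with
  | zero =>
    simp only [cliqueCount, pow_zero, sum_const, offDiag_card, hJ]
    norm_num
  | succ k ih =>
    set n : ℝ := (Fintype.card V : ℝ) with hn
    have hn0 : 0 ≤ n := by positivity
    let miss : V → Finset ι := fun w => J.filter (fun j => ¬ G.Adj (a j) w)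
    let good := Z.filter (fun w => (miss w).card ≤ 1)
    have hgood : ε * n ≤ good.card := by
      have e1 : ∑ w ∈ Z, ((miss w).card : ℝ) ≤ (k + 3) * ((2 * η - ε) * n) := by
        have : ∑ w ∈ Z, (miss w).card = ∑ j ∈ J, (Z.filter (fun w => ¬ G.Adj (a j) w)).card := by
          simp only [miss, Finset.card_filter]
          exact Finset.sum_comm
        have h2 : ∑ w ∈ Z, ((miss w).card : ℝ) = ∑ j ∈ J, ((Z.filter (fun w => ¬ G.Adj (a j) w)).card : ℝ) := by
          exact_mod_cast this
        rw [h2]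
        calc _ ≤ ∑ j ∈ J, ((2 * η - ε) * n) := by
              refine Finset.sum_le_sum fun j _ => le_trans ?_ (hdeg (a j))
              exact_mod_cast Finset.card_le_card (Finset.filter_subset_filter _ (Finset.subset_univ _))
          _ = _ := by rw [Finset.sum_const, hJ, nsmul_eq_mul]; push_cast; ring
      have e2 : 2 * (Z.card : ℝ) - 2 * good.card ≤ ∑ w ∈ Z, ((miss w).card : ℝ) := by
        have : (good.card : ℝ) = ∑ w ∈ Z, if (miss w).card ≤ 1 then (1:ℝ) else 0 := by
          simp [good]
        rw [this, Finset.card_eq_sum_ones, Nat.cast_sum, Finset.mul_sum, Finset.mul_sum,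
          ← Finset.sum_sub_distrib]
        refine Finset.sum_le_sum fun w _ => ?_
        split_ifs with h
        · simp
        · have : 2 ≤ (miss w).card := by omega
          have : (2:ℝ) ≤ (miss w).card := by exact_mod_cast this
          simpa using this
      push_cast at hZ
      have : 0 ≤ (k:ℝ) * (η * n) := by positivity
      have : 0 ≤ (k:ℝ) * (ε * n) := by positivity
      have : 0 ≤ ε * n := by positivity
      nlinarith
    have hw : ∀ w ∈ good, (ε * n) ^ k ≤ ∑ p ∈ J.offDiag,
        if (G.Adj (a p.1) w ∧ G.Adj (a p.2) w) then
          cliqueCount G k ((Z.filter (fun x => G.Adj (a p.1) x ∧ G.Adj (a p.2) x)).filter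
            (fun x => G.Adj w x)) else 0 := by
      intro w hwg
      have hwm : (miss w).card ≤ 1 := (mem_filter.1 hwg).2
      have hsub : J.filter (fun j => G.Adj (a j) w) ⊆ J := filter_subset _ _
      have hc := Finset.card_filter_add_card_filter_not (s := J) (fun j => G.Adj (a j) w)
      have hc' : k + 2 ≤ (J.filter (fun j => G.Adj (a j) w)).card := by
        simp only [miss] at hwm
        omega
      obtain ⟨J', hJ', hJc⟩ := Finset.exists_subset_card_eq hc'
      have hZw : (2 * k + 1) * η * n ≤ (Z.filter (fun x => G.Adj w x)).card := by
        have h1 := Finset.card_filter_add_card_filter_not (s := Z) (fun j => G.Adj w j)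
        have h2 : ((Z.filter (fun x => ¬ G.Adj w x)).card : ℝ) ≤ (2 * η - ε) * n := by
          refine le_trans ?_ (hdeg w)
          exact_mod_cast Finset.card_le_card (Finset.filter_subset_filter _ (Finset.subset_univ _))
        have h3 : ((Z.filter (fun x => G.Adj w x)).card : ℝ) + (Z.filter (fun x => ¬ G.Adj w x)).card = Z.card := by
          exact_mod_cast h1
        push_cast at hZ
        have : 0 ≤ ε * n := by positivity
        nlinarith
      refine (ih J' hJc _ hZw).trans ?_
      have hss : J'.offDiag ⊆ J.offDiag := Finset.offDiag_mono (hJ'.trans hsub)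
      refine le_trans ?_ (Finset.sum_le_sum_of_subset_of_nonneg hss ?_)
      · refine Finset.sum_le_sum fun p hp => ?_
        rw [mem_offDiag] at hp
        rw [if_pos ⟨(mem_filter.1 (hJ' hp.1)).2, (mem_filter.1 (hJ' hp.2.1)).2⟩]
        refine cliqueCount_mono G k ?_
        intro x; simp; tauto
      · intro p _ _
        split_ifs
        · exact cliqueCount_nonneg _ _ _
        · exact le_rfl
    calc (ε * n) ^ (k+1) = (ε * n) * (ε * n) ^ k := by ring
      _ ≤ good.card * (ε * n) ^ k := by gcongr
      _ = ∑ w ∈ good, (ε * n) ^ k := by simp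
      _ ≤ _ := Finset.sum_le_sum hw
      _ ≤ _ := Finset.sum_le_sum_of_subset_of_nonneg (filter_subset _ _) (by
            intro w _ _
            refine Finset.sum_nonneg fun p _ => ?_
            split_ifs
            · exact cliqueCount_nonneg _ _ _
            · exact le_rfl)
      _ = _ := by
          rw [Finset.sum_comm]
          refine Finset.sum_congr rfl fun p _ => ?_
          rw [cliqueCount, Finset.sum_filter]

/-- Greedy sampling. -/
lemma greedy_sample {I W : Type} [Fintype I] [Fintype W] [Nonempty W] (h : I → W → ℝ)
    (h0 : ∀ i, ∑ w, h i w = 0) (h1 : ∀ i w, (h i w) ^ 2 ≤ 1) (m : ℕ) :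
    ∃ x : Fin m → W, ∑ i, (∑ j, h i (x j)) ^ 2 ≤ m * (Fintype.card I : ℝ) := by
  induction m with
  | zero => exact ⟨Fin.elim0, by simp⟩
  | succ m ih =>
    obtain ⟨x, hx⟩ := ih
    obtain ⟨w, -, hw⟩ : ∃ w ∈ (univ : Finset W), ∑ i, (h i w + ∑ j, h i (x j)) ^ 2 ≤
        (m + 1) * (Fintype.card I : ℝ) := by
      apply Finset.exists_le_of_sum_le Finset.univ_nonempty
      rw [Finset.sum_comm]
      have : ∀ i, ∑ w, (h i w + ∑ j, h i (x j)) ^ 2 ≤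
          (Fintype.card W : ℝ) * (1 + (∑ j, h i (x j)) ^ 2) := by
        intro i
        set s := ∑ j, h i (x j)
        calc _ = ∑ w, ((h i w) ^ 2 + s ^ 2) + 2 * s * ∑ w, h i w := by
              rw [Finset.mul_sum, ← Finset.sum_add_distrib]
              refine Finset.sum_congr rfl fun w _ => by ring
          _ ≤ ∑ w : W, (1 + s ^ 2) := by
              rw [h0, mul_zero, add_zero]
              exact Finset.sum_le_sum fun w _ => by gcongr; exact h1 i w
          _ = _ := by simp; ring
      refine (Finset.sum_le_sum fun i _ => this i).trans ?_
      rw [← Finset.mul_sum, Finset.sum_add_distrib]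
      simp only [sum_const, card_univ, nsmul_eq_mul, mul_one]
      gcongr
      linarith
    refine ⟨Fin.cons w x, ?_⟩
    simpa [Fin.sum_univ_succ] using hw

noncomputable def profile {V U W : Type} [Fintype W] (P : V → W → Prop) (F : U → W → ℝ)
    (v : V) (u : U) : ℝ := (∑ w, if P v w then F u w else 0) / Fintype.card W

lemma separated_bound {V U W : Type} [Fintype U] [Fintype W] [Nonempty U]
    [Nonempty W] (P : V → W → Prop) (F : U → W → ℝ) (hF : ∀ u w, 0 ≤ F u w ∧ F u w ≤ 1)
    (δ : ℝ) (m : ℕ) (hm : 0 < m) (hδ : 8 / m ≤ δ)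
    (D : Finset V) (hD : ∀ v ∈ D, ∀ v' ∈ D, v ≠ v' →
      δ * Fintype.card U < ∑ u, (profile P F v u - profile P F v' u) ^ 2) :
    D.card ≤ 2 * 2 ^ m := by
  set g := profile P F with hg
  have hWp : (0:ℝ) < Fintype.card W := by exact_mod_cast Fintype.card_pos
  have hUp : (0:ℝ) < Fintype.card U := by exact_mod_cast Fintype.card_pos
  have hmp : (0:ℝ) < m := by exact_mod_cast hm
  have hv01 : ∀ v u w, 0 ≤ (if P v w then F u w else 0) ∧ (if P v w then F u w else 0) ≤ 1 := by
    intro v u w; split_ifs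
    · exact hF u w
    · simp
  have hg01 : ∀ v u, 0 ≤ g v u ∧ g v u ≤ 1 := by
    intro v u
    refine ⟨div_nonneg (Finset.sum_nonneg fun w _ => (hv01 v u w).1) hWp.le, ?_⟩
    rw [hg, profile, div_le_one hWp]
    calc _ ≤ ∑ w : W, (1:ℝ) := Finset.sum_le_sum fun w _ => (hv01 v u w).2
      _ = _ := by simp
  obtain ⟨x, hx⟩ := greedy_sample (I := D × U) (W := W)
    (fun i w => (if P i.1 w then F i.2 w else 0) - g i.1 i.2)
    (by
      rintro ⟨v, u⟩
      simp only [hg, profile, Finset.sum_sub_distrib, sum_const, card_univ, nsmul_eq_mul]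
      field_simp
      simp)
    (by
      rintro ⟨v, u⟩ w
      have := hv01 v u w
      have := hg01 v u
      rw [sq_le_one_iff_abs_le_one, abs_le]
      constructor <;> simp only <;> linarith) m
  let gh : V → U → ℝ := fun v u => (∑ j, if P v (x j) then F u (x j) else 0) / m
  let E : V → ℝ := fun v => ∑ u, (gh v u - g v u) ^ 2
  have hE : ∑ v ∈ D, E v ≤ D.card * Fintype.card U / m := by
    have e : ∀ v u, (∑ j, ((if P v (x j) then F u (x j) else 0) - g v u)) ^ 2
        = m ^ 2 * (gh v u - g v u) ^ 2 := by
      intro v u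
      simp only [gh, Finset.sum_sub_distrib, sum_const, card_univ, nsmul_eq_mul, Fintype.card_fin]
      field_simp
    rw [Fintype.sum_prod_type] at hx
    simp only [e] at hx
    simp only [← Finset.mul_sum] at hx
    rw [Finset.sum_coe_sort D (fun v => ∑ u, (gh v u - g v u) ^ 2)] at hx
    simp only [Fintype.card_prod, Fintype.card_coe] at hx
    push_cast at hx
    rw [le_div_iff₀ hmp]
    have : (m:ℝ) * ((∑ v ∈ D, E v) * m) ≤ m * (D.card * Fintype.card U) := by
      simp only [E]; linarith
    exact le_of_mul_le_mul_left this hmp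
  by_contra! hlt
  let D' := D.filter (fun v => E v ≤ 2 * Fintype.card U / m)
  have hE0 : ∀ v, 0 ≤ E v := fun v => Finset.sum_nonneg fun u _ => sq_nonneg _
  have hD' : D.card ≤ 2 * D'.card := by
    have h1 := Finset.card_filter_add_card_filter_not (s := D) (fun v => E v ≤ 2 * Fintype.card U / m)
    have h2 : ((D.filter (fun v => ¬ E v ≤ 2 * Fintype.card U / m)).card : ℝ) * (2 * Fintype.card U / m)
        ≤ ∑ v ∈ D, E v := by
      rw [← nsmul_eq_mul]
      refine (Finset.card_nsmul_le_sum _ E _ ?_).trans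
        (Finset.sum_le_sum_of_subset_of_nonneg (filter_subset _ _) fun v _ _ => hE0 v)
      intro v hv
      exact (not_le.1 (mem_filter.1 hv).2).le
    have h3 := h2.trans hE
    have h4 : ((D.filter (fun v => ¬ E v ≤ 2 * Fintype.card U / m)).card : ℝ) * 2 ≤ D.card := by
      have hq : 0 < (Fintype.card U : ℝ) / m := by positivity
      refine le_of_mul_le_mul_right ?_ hq
      calc _ = ((D.filter (fun v => ¬ E v ≤ 2 * Fintype.card U / m)).card : ℝ) * (2 * Fintype.card U / m) := by ring
        _ ≤ _ := h3
        _ = _ := by ring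
    have h5 : ((D.filter (fun v => ¬ E v ≤ 2 * Fintype.card U / m)).card) * 2 ≤ D.card := by
      exact_mod_cast h4
    simp only [D']
    omega
  have hpg : (univ : Finset (Fin m → Prop)).card < D'.card := by
    rw [card_univ]
    simp only [Fintype.card_fun, Fintype.card_fin, Fintype.card_prop]
    omega
  obtain ⟨v, hv, v', hv', hne, heq⟩ := Finset.exists_ne_map_eq_of_card_lt_of_maps_to hpg
    (f := fun v j => P v (x j)) (fun _ _ => by simp)
  have hgh : ∀ u, gh v u = gh v' u := by
    intro u
    simp only [gh]
    congr 1
    refine Finset.sum_congr rfl fun j _ => ?_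
    have : P v (x j) = P v' (x j) := congrFun heq j
    simp only [this]
  have hsep := hD v (mem_filter.1 hv).1 v' (mem_filter.1 hv').1 hne
  have : ∑ u, (g v u - g v' u) ^ 2 ≤ 2 * E v + 2 * E v' := by
    simp only [E]
    rw [Finset.mul_sum, Finset.mul_sum, ← Finset.sum_add_distrib]
    refine Finset.sum_le_sum fun u _ => ?_
    rw [hgh u]
    nlinarith [sq_nonneg ((gh v' u - g v u) + (gh v' u - g v' u))]
  have e1 := (mem_filter.1 hv).2
  have e2 := (mem_filter.1 hv').2
  have : δ * Fintype.card U < 8 / m * Fintype.card U := by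
    calc _ < _ := hsep
      _ ≤ _ := this
      _ ≤ 2 * (2 * Fintype.card U / m) + 2 * (2 * Fintype.card U / m) := by linarith
      _ = _ := by ring
  have := mul_le_mul_of_nonneg_right hδ hUp.le
  linarith

lemma exists_cover (δ : ℝ) (hδ : 0 < δ) : ∃ K : ℕ, ∀ (V U W : Type) [Fintype V] [Fintype U]
    [Fintype W] [Nonempty U] [Nonempty W] (P : V → W → Prop) (F : U → W → ℝ),
    (∀ u w, 0 ≤ F u w ∧ F u w ≤ 1) → ∃ k ≤ K, ∃ (c : V → Fin k) (z : Fin k → V),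
      ∀ v, ∑ u, (profile P F v u - profile P F (z (c v)) u) ^ 2 ≤ δ * Fintype.card U := by
  obtain ⟨m, hm⟩ := exists_nat_gt (8 / δ)
  have hm0 : (0:ℝ) < m := lt_trans (by positivity) hm
  refine ⟨2 * 2 ^ m, ?_⟩
  intro V U W _ _ _ _ _ P F hF
  let sep : Finset V → Prop := fun D => ∀ v ∈ D, ∀ v' ∈ D, v ≠ v' →
      δ * Fintype.card U < ∑ u, (profile P F v u - profile P F v' u) ^ 2
  obtain ⟨D, hD, hmax⟩ := Finset.exists_max_image (univ.filter sep) Finset.card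
    ⟨∅, by simp [sep]⟩
  have hDs : sep D := (mem_filter.1 hD).2
  have hb := separated_bound P F hF δ m (by exact_mod_cast hm0)
    (by rw [div_le_iff₀ hm0]; rw [div_lt_iff₀ hδ] at hm; linarith) D hDs
  have hcl : ∀ v, ∃ d : D, ∑ u, (profile P F v u - profile P F d u) ^ 2 ≤ δ * Fintype.card U := by
    intro v
    by_contra! hc
    have hvD : v ∉ D := by
      intro hv
      have := hc ⟨v, hv⟩
      simp at this
      have : 0 ≤ δ * Fintype.card U := by positivity
      linarith
    have hs : sep (insert v D) := by
      intro x hx y hy hxy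
      rw [mem_insert] at hx hy
      rcases hx with rfl | hx <;> rcases hy with rfl | hy
      · exact absurd rfl hxy
      · exact hc ⟨y, hy⟩
      · have := hc ⟨x, hx⟩
        refine this.trans_eq (Finset.sum_congr rfl fun u _ => by ring)
      · exact hDs x hx y hy hxy
    have := hmax _ (mem_filter.2 ⟨mem_univ _, hs⟩)
    rw [Finset.card_insert_of_notMem hvD] at this
    omega
  choose d hd using hcl
  refine ⟨D.card, hb, fun v => D.equivFin (d v), fun i => D.equivFin.symm i, ?_⟩
  intro v
  simpa using hd v

lemma not_cliqueFree_of_pairwise (m : ℕ) (f : Fin m → V) (hf : ∀ i j, i ≠ j → G.Adj (f i) (f j)) :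
    ¬ G.CliqueFree m := by
  have hinj : Function.Injective f := by
    intro i j hij
    by_contra hne
    exact G.irrefl (hij ▸ hf i j hne)
  intro h
  refine h (univ.image f) ⟨?_, by rw [Finset.card_image_of_injective _ hinj]; simp⟩
  intro x hx y hy hxy
  simp only [coe_image, coe_univ, Set.image_univ, Set.mem_range] at hx hy
  obtain ⟨i, rfl⟩ := hx
  obtain ⟨j, rfl⟩ := hy
  exact hf i j fun h => hxy (h ▸ rfl)

lemma cliqueCount_adj [Fintype V] (k : ℕ) (hfree : G.CliqueFree (k + 2)) (u v : V)
    (h : G.Adj u v) : cliqueCount G k (univ.filter (fun x => G.Adj u x ∧ G.Adj v x)) = 0 := by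
  by_contra hne
  obtain ⟨t, ht, ht'⟩ := exists_clique_of_pos G k _
    (lt_of_le_of_ne (cliqueCount_nonneg G k _) (Ne.symm hne))
  simp only [mem_filter, mem_univ, true_and] at ht
  refine not_cliqueFree_of_pairwise G (k + 2) (Fin.cons u (Fin.cons v t)) ?_ hfree
  intro i j
  refine Fin.cases ?_ (fun i => Fin.cases ?_ (fun i => ?_) i) i <;>
    refine Fin.cases ?_ (fun j => Fin.cases ?_ (fun j => ?_) j) j <;> intro hij
  · exact absurd rfl hij
  · simpa using h
  · simpa using (ht j).1
  · simpa using h.symm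
  · exact absurd rfl hij
  · simpa using (ht j).2
  · simpa using (ht i).1.symm
  · simpa using (ht i).2.symm
  · simpa using ht' i j (by simpa using hij)

lemma exists_pair [Fintype V] [Nonempty V] {ι : Type} [Fintype ι] (a : ι → V) (k : ℕ)
    (hι : Fintype.card ι = k + 2) (η ε : ℝ) (hε : 0 < ε) (hη : 0 ≤ η)
    (hdeg : ∀ v, ((univ.filter (fun x => ¬ G.Adj v x)).card : ℝ) ≤ (2 * η - ε) * Fintype.card V)
    (hk : (2 * k + 1) * η ≤ 1) (κ : ℝ) (hκ : κ = ε ^ k / (k + 2) ^ 2) :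
    ∃ i j, i ≠ j ∧ κ * (Fintype.card V : ℝ) ^ k ≤
      cliqueCount G k (univ.filter (fun x => G.Adj (a i) x ∧ G.Adj (a j) x)) := by
  have hn : (0:ℝ) < Fintype.card V := by exact_mod_cast Fintype.card_pos
  have h := pairs_lower G a η ε hε hη hdeg k univ (by rw [card_univ, hι]) univ (by
    rw [card_univ]; nlinarith)
  by_contra! hc
  have hoff : ((univ : Finset ι).offDiag.card : ℝ) < (k + 2) ^ 2 := by
    rw [offDiag_card, card_univ, hι]
    have : (k + 2) * (k + 2) - (k + 2) < (k + 2) ^ 2 := by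
      have : 0 < (k + 2) * (k + 2) := by positivity
      rw [sq]; omega
    exact_mod_cast this
  have h2 : ∑ p ∈ (univ : Finset ι).offDiag,
      cliqueCount G k (univ.filter (fun x => G.Adj (a p.1) x ∧ G.Adj (a p.2) x)) ≤
      (univ : Finset ι).offDiag.card • (κ * (Fintype.card V : ℝ) ^ k) :=
    Finset.sum_le_card_nsmul _ _ _ fun p hp => (hc p.1 p.2 (mem_offDiag.1 hp).2.2).le
  have hκ0 : 0 < κ * (Fintype.card V : ℝ) ^ k := by rw [hκ]; positivity
  have h3 : (ε * Fintype.card V) ^ k = (k + 2) ^ 2 * (κ * (Fintype.card V : ℝ) ^ k) := by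
    rw [hκ, mul_pow]; field_simp
  rw [nsmul_eq_mul] at h2
  have := mul_lt_mul_of_pos_right hoff hκ0
  linarith

/-- An edge between two classes is incompatible with many cliques in the common neighbourhood of
the centres. -/
lemma edge_core [Fintype V] [Nonempty V] (k : ℕ) (hfree : G.CliqueFree (k + 2)) (η ε : ℝ)
    (hε : 0 < ε) (hη : 0 ≤ η)
    (hdeg : ∀ v, ((univ.filter (fun x => ¬ G.Adj v x)).card : ℝ) ≤ (2 * η - ε) * Fintype.card V)
    (hk : (2 * k + 1) * η ≤ 1) (γ κ : ℝ) (hγ0 : 0 ≤ γ) (hκ : κ = ε ^ k / (k + 2) ^ 2)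
    (hγ : k * (2 * γ) < κ)
    (a b a' b' : V) (hab : G.Adj a' b') (Ba Bb : Finset V)
    (hBa : (Ba.card : ℝ) ≤ γ * Fintype.card V) (hBb : (Bb.card : ℝ) ≤ γ * Fintype.card V)
    (ha : ∀ u ∉ Ba, |cliqueCount G k (univ.filter (fun x => G.Adj u x ∧ G.Adj a' x)) -
      cliqueCount G k (univ.filter (fun x => G.Adj u x ∧ G.Adj a x))| <
        κ * (Fintype.card V : ℝ) ^ k)
    (hb : ∀ u ∉ Bb, |cliqueCount G k (univ.filter (fun x => G.Adj u x ∧ G.Adj b' x)) -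
      cliqueCount G k (univ.filter (fun x => G.Adj u x ∧ G.Adj b x))| <
        κ * (Fintype.card V : ℝ) ^ k) :
    cliqueCount G k (univ.filter (fun x => G.Adj a x ∧ G.Adj b x)) <
      κ * (Fintype.card V : ℝ) ^ k := by
  by_contra! hc
  have hn : (0:ℝ) < Fintype.card V := by exact_mod_cast Fintype.card_pos
  have hnk : (0:ℝ) < (Fintype.card V : ℝ) ^ k := by positivity
  have hB : ((Ba ∪ Bb).card : ℝ) ≤ 2 * γ * Fintype.card V := by
    have : ((Ba ∪ Bb).card : ℝ) ≤ Ba.card + Bb.card := by exact_mod_cast Finset.card_union_le _ _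
    linarith
  have h1 := cliqueCount_sdiff G k (univ.filter (fun x => G.Adj a x ∧ G.Adj b x)) (Ba ∪ Bb)
    (2 * γ) (by linarith) hB
  have h2 := mul_lt_mul_of_pos_right hγ hnk
  obtain ⟨w, hw, hw'⟩ := exists_clique_of_pos G k _ (show 0 < _ by linarith)
  simp only [mem_sdiff, mem_filter, mem_univ, true_and, mem_union, not_or] at hw
  have hκ0 : 0 < κ * (Fintype.card V : ℝ) ^ k := by rw [hκ]; positivity
  have hwa : ∀ i, cliqueCount G k (univ.filter (fun x => G.Adj (w i) x ∧ G.Adj a' x)) <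
      κ * (Fintype.card V : ℝ) ^ k := by
    intro i
    have := ha (w i) (hw i).2.1
    rw [cliqueCount_adj G k hfree (w i) a (hw i).1.1.symm, sub_zero] at this
    exact (le_abs_self _).trans_lt this
  have hwb : ∀ i, cliqueCount G k (univ.filter (fun x => G.Adj (w i) x ∧ G.Adj b' x)) <
      κ * (Fintype.card V : ℝ) ^ k := by
    intro i
    have := hb (w i) (hw i).2.2
    rw [cliqueCount_adj G k hfree (w i) b (hw i).1.2.symm, sub_zero] at this
    exact (le_abs_self _).trans_lt this
  obtain ⟨i, j, hij, hle⟩ := exists_pair G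
    (Sum.elim w (fun t : Bool => if t then a' else b')) k (by simp) η ε hε hη hdeg hk κ hκ
  have hadj : ∀ u v, G.Adj u v → κ * (Fintype.card V : ℝ) ^ k ≤
      cliqueCount G k (univ.filter (fun x => G.Adj u x ∧ G.Adj v x)) → False := by
    intro u v huv h
    rw [cliqueCount_adj G k hfree u v huv] at h
    linarith
  rcases i with i | i <;> rcases j with j | j
  · exact hadj _ _ (hw' i j (by simpa using hij)) hle
  · cases j
    · exact absurd hle (not_le.2 (hwb i))
    · exact absurd hle (not_le.2 (hwa i))
  · simp only [and_comm (a := G.Adj (Sum.elim w _ (Sum.inr i)) _)] at hle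
    cases i
    · exact absurd hle (not_le.2 (hwb j))
    · exact absurd hle (not_le.2 (hwa j))
  · cases i <;> cases j
    · exact hij rfl
    · exact hadj _ _ hab.symm hle
    · exact hadj _ _ hab hle
    · exact hij rfl

end

/-- For every integer `r ≥ 3` and every `ε > 0` there exists a positive integer `L`
such that every `K_r`-free graph `G` on `n` vertices with minimum degree at least
`((2r-5)/(2r-3) + ε) * n` admits a graph homomorphism into some `K_r`-free graph `H`
on at most `L` vertices. -/
theorem homomorphism_threshold_cliques (r : ℕ) (hr : 3 ≤ r) (ε : ℝ) (hε : 0 < ε) :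
    ∃ L : ℕ, 0 < L ∧
      ∀ (V : Type) [Fintype V] (G : SimpleGraph V) [DecidableRel G.Adj],
        G.CliqueFree r →
        ((2 * (r : ℝ) - 5) / (2 * (r : ℝ) - 3) + ε) * Fintype.card V ≤ G.minDegree →
        ∃ (k : ℕ) (H : SimpleGraph (Fin k)),
          k ≤ L ∧ H.CliqueFree r ∧ Nonempty (G →g H) := by
  classical
  obtain ⟨k, rfl⟩ : ∃ k, r = k + 2 := ⟨r - 2, by omega⟩
  have hk1 : 1 ≤ k := by omega
  have hk1' : (1:ℝ) ≤ k := by exact_mod_cast hk1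
  set κ : ℝ := ε ^ k / (k + 2) ^ 2 with hκ
  have hκ0 : 0 < κ := by positivity
  set γ : ℝ := κ / (4 * k) with hγ
  have hγ0 : 0 < γ := by positivity
  obtain ⟨K, hK⟩ := exists_cover (κ ^ 2 * γ) (by positivity)
  refine ⟨K + 1, by omega, ?_⟩
  intro V _ G _ hfree hmin
  rcases isEmpty_or_nonempty V with hV | hV
  · exact ⟨0, ⊥, by omega, SimpleGraph.cliqueFree_of_card_lt (by simp),
      ⟨⟨fun v => hV.elim v, fun {v} => hV.elim v⟩⟩⟩
  have hn : (0:ℝ) < Fintype.card V := by exact_mod_cast Fintype.card_pos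
  set η : ℝ := 1 / (2 * k + 1) with hη
  have hη0 : 0 ≤ η := by positivity
  have hkη : (2 * (k:ℝ) + 1) * η ≤ 1 := by rw [hη]; field_simp; exact le_rfl
  have hdeg : ∀ v, ((Finset.univ.filter (fun x => ¬ G.Adj v x)).card : ℝ) ≤
      (2 * η - ε) * Fintype.card V := by
    intro v
    have h1 := Finset.card_filter_add_card_filter_not (s := (Finset.univ : Finset V))
      (fun x => G.Adj v x)
    have h2 : (Finset.univ.filter (fun x => G.Adj v x)).card = G.degree v := by
      rw [← SimpleGraph.card_neighborFinset_eq_degree, SimpleGraph.neighborFinset_eq_filter]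
    have h3 : (G.minDegree : ℝ) ≤ G.degree v := by exact_mod_cast G.minDegree_le_degree v
    have h4 : ((Finset.univ.filter (fun x => G.Adj v x)).card : ℝ) +
        (Finset.univ.filter (fun x => ¬ G.Adj v x)).card = Fintype.card V := by
      rw [← Finset.card_univ]; exact_mod_cast h1
    rw [h2] at h4
    have h5 : (2 * ((k + 2 : ℕ) : ℝ) - 5) / (2 * ((k + 2 : ℕ) : ℝ) - 3) = 1 - 2 * η := by
      rw [hη]; push_cast
      have : (2 * ((k:ℝ) + 2) - 3) = 2 * k + 1 := by ring
      rw [this]; field_simp; ring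
    rw [h5] at hmin
    nlinarith
  obtain ⟨F, hF, hrep⟩ := cliqueCount_repr G k
  obtain ⟨q, hq, c, z, hcz⟩ := hK V V (Fin k → V) (fun v w => ∀ i, G.Adj v (w i))
    (fun u w => if ∀ i, G.Adj u (w i) then F w else 0) (by
      intro u w; split_ifs
      · exact hF w
      · simp)
  set g := profile (fun v (w : Fin k → V) => ∀ i, G.Adj v (w i))
    (fun u w => if ∀ i, G.Adj u (w i) then F w else 0) with hg
  have hgc : ∀ v u, cliqueCount G k (Finset.univ.filter (fun x => G.Adj u x ∧ G.Adj v x)) =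
      g v u * (Fintype.card V : ℝ) ^ k := by
    intro v u
    have : (Fintype.card (Fin k → V) : ℝ) = (Fintype.card V : ℝ) ^ k := by simp
    rw [hg, profile, this, div_mul_cancel₀ _ (by positivity), hrep]
    refine Finset.sum_congr rfl fun w _ => ?_
    simp only [Finset.mem_filter, Finset.mem_univ, true_and, forall_and, ← ite_and]
    congr 1
    rw [and_comm]
  let Bad : V → Finset V := fun v => Finset.univ.filter (fun u => κ ≤ |g v u - g (z (c v)) u|)
  have hBad : ∀ v, ((Bad v).card : ℝ) ≤ γ * Fintype.card V := by
    intro v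
    have h1 : ((Bad v).card : ℝ) * κ ^ 2 ≤ ∑ u, (g v u - g (z (c v)) u) ^ 2 := by
      rw [← nsmul_eq_mul]
      refine (Finset.card_nsmul_le_sum _ (fun u => (g v u - g (z (c v)) u) ^ 2) _ ?_).trans
        (Finset.sum_le_sum_of_subset_of_nonneg (Finset.filter_subset _ _)
          fun u _ _ => sq_nonneg _)
      intro u hu
      have := (Finset.mem_filter.1 hu).2
      rw [← sq_abs (g v u - g (z (c v)) u)]
      gcongr
    have h2 := h1.trans (hcz v)
    have hκ2 : 0 < κ ^ 2 := by positivity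
    refine le_of_mul_le_mul_right ?_ hκ2
    linarith
  have hclose : ∀ v, ∀ u ∉ Bad v,
      |cliqueCount G k (Finset.univ.filter (fun x => G.Adj u x ∧ G.Adj v x)) -
      cliqueCount G k (Finset.univ.filter (fun x => G.Adj u x ∧ G.Adj (z (c v)) x))| <
        κ * (Fintype.card V : ℝ) ^ k := by
    intro v u hu
    have hu' : |g v u - g (z (c v)) u| < κ := by simpa [Bad] using hu
    have hnk : (0:ℝ) < (Fintype.card V : ℝ) ^ k := by positivity
    rw [hgc, hgc, ← sub_mul, abs_mul, abs_of_pos hnk]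
    exact mul_lt_mul_of_pos_right hu' hnk
  have hcore : ∀ v v', G.Adj v v' → cliqueCount G k (Finset.univ.filter
      (fun x => G.Adj (z (c v)) x ∧ G.Adj (z (c v')) x)) < κ * (Fintype.card V : ℝ) ^ k := by
    intro v v' hvv
    have key := edge_core G k hfree η ε hε hη0 ?_ hkη γ κ hγ0.le hκ ?_ (z (c v)) (z (c v'))
      v v' hvv (Bad v) (Bad v') (hBad v) (hBad v') ?_ ?_
    · convert key
    · intro v; convert hdeg v
    · rw [hγ]; field_simp; linarith
    · intro u hu; convert hclose v u hu
    · intro u hu; convert hclose v' u hu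
  have hpair : ∀ a : Fin (k + 2) → V, ∃ i j, i ≠ j ∧ κ * (Fintype.card V : ℝ) ^ k ≤
      cliqueCount G k (Finset.univ.filter (fun x => G.Adj (a i) x ∧ G.Adj (a j) x)) := by
    intro a
    obtain ⟨i, j, hij, h⟩ := exists_pair G a k (by simp) η ε hε hη0
      (fun v => by convert hdeg v) hkη κ hκ
    exact ⟨i, j, hij, by convert h⟩
  let H : SimpleGraph (Fin q) := SimpleGraph.fromRel
    (fun x y => ∃ v v', c v = x ∧ c v' = y ∧ G.Adj v v')
  have hHadj : ∀ x y, H.Adj x y → cliqueCount G k (Finset.univ.filter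
      (fun t => G.Adj (z x) t ∧ G.Adj (z y) t)) < κ * (Fintype.card V : ℝ) ^ k := by
    intro x y hxy
    rw [SimpleGraph.fromRel_adj] at hxy
    rcases hxy.2 with ⟨v, v', rfl, rfl, h⟩ | ⟨v, v', rfl, rfl, h⟩
    · exact hcore v v' h
    · exact hcore v' v h.symm
  refine ⟨q, H, by omega, ?_, ⟨⟨c, ?_⟩⟩⟩
  · by_contra hnot
    let e := SimpleGraph.topEmbeddingOfNotCliqueFree hnot
    obtain ⟨i, j, hij, h⟩ := hpair (fun i => z (e i))
    exact absurd h (not_le.2 (hHadj _ _ (e.map_rel_iff.2 (by simpa using hij))))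
  · intro v v' hvv
    rw [SimpleGraph.fromRel_adj]
    refine ⟨?_, Or.inl ⟨v, v', rfl, rfl, hvv⟩⟩
    intro hcc
    obtain ⟨i, j, hij, h⟩ := hpair (fun _ => z (c v))
    have := hcore v v' hvv
    rw [← hcc] at this
    linarith
end

section
/- Let r ≥ 3 be an integer and ε > 0 a real number, and set m = ⌈4 ln(8/ε)/ε²⌉ + 1, T = 2^m and L = 2^T + T. Then for every n > L and every maximal K_r-free graph G on n vertices with minimum degree δ(G) ≥ ((2r-5)/(2r-3) + ε)·n, there exists a K_r-free graph H on at most L vertices such that G admits a graph homomorphism into H. -/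
open Finset in
/-- Exponential moment bound for a uniformly random tuple. -/
theorem aux_tail {V : Type} [Fintype V] (m : ℕ) (ε : ℝ) (hε : 0 < ε) (Y : V → ℝ)
    (h1 : ∀ v, |Y v| ≤ 1) (h0 : ∑ v, Y v = 0) (P : Finset (Fin m → V))
    (hP : ∀ X ∈ P, ε * m ≤ ∑ i, Y (X i)) :
    (P.card : ℝ) ≤ Real.exp (-(ε ^ 2 * m / 2)) * (Fintype.card V : ℝ) ^ m := by
  classical
  have hsum : ∑ v, Real.exp (ε * Y v) ≤ Fintype.card V * Real.exp (ε ^ 2 / 2) := by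
    have hpt : ∀ v, Real.exp (ε * Y v) ≤ Real.cosh ε + Y v * Real.sinh ε := by
      intro v
      have hb := abs_le.mp (h1 v)
      have hc := convexOn_exp.2 (Set.mem_univ ε) (Set.mem_univ (-ε))
        (show 0 ≤ (1 + Y v) / 2 by linarith) (show 0 ≤ (1 - Y v) / 2 by linarith) (by ring)
      simp only [smul_eq_mul] at hc
      have e1 : (1 + Y v) / 2 * ε + (1 - Y v) / 2 * (-ε) = ε * Y v := by ring
      rw [e1] at hc
      rw [Real.cosh_eq, Real.sinh_eq]
      linarith
    calc ∑ v, Real.exp (ε * Y v) ≤ ∑ v, (Real.cosh ε + Y v * Real.sinh ε) :=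
          sum_le_sum fun v _ => hpt v
      _ = Fintype.card V * Real.cosh ε := by
          rw [sum_add_distrib, ← sum_mul, h0]; simp
      _ ≤ _ := by
          have := Real.cosh_le_exp_half_sq ε
          gcongr
  have hexp : ∑ X : Fin m → V, Real.exp (ε * ∑ i, Y (X i))
      = (∑ v, Real.exp (ε * Y v)) ^ m := by
    have := Finset.prod_univ_sum (fun _ : Fin m => (Finset.univ : Finset V))
      (fun _ v => Real.exp (ε * Y v))
    simp only [Fintype.piFinset_univ, prod_const, card_univ, Fintype.card_fin] at this
    rw [this]
    refine sum_congr rfl fun X _ => ?_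
    rw [mul_sum, Real.exp_sum]
  have hlow : (P.card : ℝ) * Real.exp (ε * (ε * m))
      ≤ ∑ X : Fin m → V, Real.exp (ε * ∑ i, Y (X i)) := by
    calc (P.card : ℝ) * Real.exp (ε * (ε * m)) = ∑ X ∈ P, Real.exp (ε * (ε * m)) := by simp
      _ ≤ ∑ X ∈ P, Real.exp (ε * ∑ i, Y (X i)) := by
          refine sum_le_sum fun X hX => ?_
          have := hP X hX
          gcongr
      _ ≤ _ := sum_le_sum_of_subset_of_nonneg (subset_univ _) fun _ _ _ => (Real.exp_pos _).le
  have hup : (P.card : ℝ) * Real.exp (ε * (ε * m))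
      ≤ (Fintype.card V * Real.exp (ε ^ 2 / 2)) ^ m := by
    rw [hexp] at hlow
    refine hlow.trans ?_
    gcongr
  have he : (Fintype.card V * Real.exp (ε ^ 2 / 2)) ^ m
      = (Real.exp (-(ε ^ 2 * m / 2)) * (Fintype.card V : ℝ) ^ m) * Real.exp (ε * (ε * m)) := by
    rw [mul_pow, ← Real.exp_nat_mul,
      mul_comm (Real.exp (-(ε ^ 2 * m / 2))), mul_assoc, ← Real.exp_add]
    congr 2
    ring
  rw [he] at hup
  exact le_of_mul_le_mul_right hup (Real.exp_pos _)

open Finset in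
/-- Number of coordinates of the tuple in `S`, as a sum of indicators. -/
theorem aux_sample {V : Type} [Fintype V] [Nonempty V] (m : ℕ) (ε τ : ℝ) (hε : 0 < ε)
    (S : Finset V) (P : Finset (Fin m → V)) [DecidableEq V]
    (h : ((S.card : ℝ) ≤ (τ - ε) * Fintype.card V ∧
            ∀ X ∈ P, τ * m ≤ ((univ.filter fun i => X i ∈ S).card : ℝ)) ∨
         ((τ + ε) * Fintype.card V ≤ (S.card : ℝ) ∧
            ∀ X ∈ P, ((univ.filter fun i => X i ∈ S).card : ℝ) < τ * m)) :
    (P.card : ℝ) ≤ Real.exp (-(ε ^ 2 * m / 2)) * (Fintype.card V : ℝ) ^ m := by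
  have hn : (0 : ℝ) < Fintype.card V := by exact_mod_cast Fintype.card_pos
  set p : ℝ := S.card / Fintype.card V with hp
  have hpn : p * Fintype.card V = S.card := by rw [hp]; field_simp
  have hp0 : 0 ≤ p := by positivity
  have hp1 : p ≤ 1 := by
    rw [hp, div_le_one hn]; exact_mod_cast card_le_univ S
  have hm : (0 : ℝ) ≤ m := by positivity
  have hsum : ∑ v, ((if v ∈ S then (1 : ℝ) else 0) - p) = 0 := by
    simp only [sum_sub_distrib, sum_const, card_univ, nsmul_eq_mul]
    simp
    linarith
  have hcnt : ∀ X : Fin m → V, ∑ i, ((if X i ∈ S then (1 : ℝ) else 0) - p)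
      = ((univ.filter fun i => X i ∈ S).card : ℝ) - p * m := by
    intro X
    simp only [sum_sub_distrib, sum_const, card_univ, nsmul_eq_mul, Fintype.card_fin]
    simp [mul_comm]
  rcases h with ⟨hS, hX⟩ | ⟨hS, hX⟩
  · refine aux_tail m ε hε (fun v => (if v ∈ S then (1 : ℝ) else 0) - p) ?_ hsum P ?_
    · intro v; rw [abs_le]; split_ifs <;> constructor <;> linarith
    · intro X hXP
      rw [hcnt]
      have := hX X hXP
      have h2 : p ≤ τ - ε := by rw [hp, div_le_iff₀ hn]; exact hS
      nlinarith
  · refine aux_tail m ε hε (fun v => -((if v ∈ S then (1 : ℝ) else 0) - p)) ?_ ?_ P ?_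
    · intro v; rw [abs_le]; split_ifs <;> constructor <;> linarith
    · rw [sum_neg_distrib, hsum, neg_zero]
    · intro X hXP
      rw [sum_neg_distrib, hcnt]
      have := hX X hXP
      have h2 : τ + ε ≤ p := by rw [hp, le_div_iff₀ hn]; exact hS
      nlinarith

open Finset in
/-- Common neighbourhoods of small sets are large. -/
theorem aux_common {V : Type} [Fintype V] [DecidableEq V] (G : SimpleGraph V)
    [DecidableRel G.Adj] (D : ℝ)
    (hD : ∀ x, ((univ.filter fun z => ¬ G.Adj x z).card : ℝ) ≤ D) (Q : Finset V) :
    (Fintype.card V : ℝ) - Q.card * D ≤ ((univ.filter fun z => ∀ q ∈ Q, G.Adj q z).card : ℝ) := by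
  have h1 : (univ : Finset V) ⊆ (univ.filter fun z => ∀ q ∈ Q, G.Adj q z) ∪
      Q.biUnion (fun q => univ.filter fun z => ¬ G.Adj q z) := by
    intro z _
    simp only [mem_union, mem_filter, mem_univ, true_and, mem_biUnion]
    by_contra! h
    obtain ⟨⟨q, hq, hn⟩, h2⟩ := h
    exact hn (h2 q hq)
  have h2 := (card_le_card h1).trans (card_union_le _ _)
  have h3 : ((Q.biUnion (fun q => univ.filter fun z => ¬ G.Adj q z)).card : ℝ) ≤ Q.card * D := by
    calc ((Q.biUnion (fun q => univ.filter fun z => ¬ G.Adj q z)).card : ℝ)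
        ≤ ((∑ q ∈ Q, (univ.filter fun z => ¬ G.Adj q z).card : ℕ) : ℝ) := by
          exact_mod_cast card_biUnion_le
      _ ≤ ∑ q ∈ Q, D := by push_cast; exact sum_le_sum fun q _ => hD q
      _ = _ := by simp
  have h4 : (Fintype.card V : ℝ) ≤ ((univ.filter fun z => ∀ q ∈ Q, G.Adj q z).card : ℝ) +
      ((Q.biUnion (fun q => univ.filter fun z => ¬ G.Adj q z)).card : ℝ) := by
    exact_mod_cast h2
  linarith

open Finset in
/-- Small cliques extend. -/
theorem aux_extend {V : Type} [Fintype V] [DecidableEq V] (G : SimpleGraph V)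
    [DecidableRel G.Adj] (D : ℝ)
    (hD : ∀ x, ((univ.filter fun z => ¬ G.Adj x z).card : ℝ) ≤ D) (k : ℕ)
    (hk : ∀ j : ℕ, j < k → (0 : ℝ) < Fintype.card V - j * D) :
    ∀ (d j : ℕ), j + d = k → ∀ Q : Finset V, G.IsNClique j Q → ∃ Q', Q ⊆ Q' ∧ G.IsNClique k Q' := by
  intro d
  induction d with
  | zero => intro j hj Q hQ; exact ⟨Q, Subset.rfl, by rwa [← hj]⟩
  | succ d ih =>
    intro j hj Q hQ
    have h1 := aux_common G D hD Q
    rw [hQ.card_eq] at h1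
    have h2 := hk j (by omega)
    have h3 : 0 < (univ.filter fun z => ∀ q ∈ Q, G.Adj q z).card := by
      exact_mod_cast h2.trans_le h1
    obtain ⟨z, hz⟩ := card_pos.mp h3
    simp only [mem_filter, mem_univ, true_and] at hz
    obtain ⟨Q', hQ', hc⟩ := ih (j + 1) (by omega) (insert z Q) (hQ.insert fun q hq => (hz q hq).symm)
    exact ⟨Q', (subset_insert _ _).trans hQ', hc⟩

open Finset in
/-- Non-adjacent (possibly equal) vertices have a common `(r-2)`-clique. -/
theorem aux_nonadj {V : Type} [Fintype V] [DecidableEq V] (G : SimpleGraph V)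
    [DecidableRel G.Adj] (D : ℝ)
    (hD : ∀ x, ((univ.filter fun z => ¬ G.Adj x z).card : ℝ) ≤ D) (s : ℕ)
    (hk : ∀ j : ℕ, j < s + 1 → (0 : ℝ) < Fintype.card V - j * D)
    (hfree : G.CliqueFree (s + 2))
    (hmax : ∀ x y : V, x ≠ y → ¬ G.Adj x y →
      ¬ (G ⊔ SimpleGraph.edge x y).CliqueFree (s + 2))
    (x y : V) (hxy : ¬ G.Adj x y) :
    ∃ Q : Finset V, x ∉ Q ∧ y ∉ Q ∧ G.IsNClique (s + 1) (insert x Q) ∧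
      G.IsNClique (s + 1) (insert y Q) := by
  by_cases h : x = y
  · subst h
    obtain ⟨Q, hQ, hc⟩ := aux_extend G D hD (s + 1) hk s 1 (by omega) {x} (by simp)
    have hx : x ∈ Q := hQ (by simp)
    exact ⟨Q.erase x, notMem_erase _ _, notMem_erase _ _, by rwa [insert_erase hx],
      by rwa [insert_erase hx]⟩
  · have hM : Maximal (fun H : SimpleGraph V => H.CliqueFree (s + 1 + 1)) G := by
      refine ⟨hfree, fun H hH hGH a b hab => ?_⟩
      by_contra hn
      refine hmax a b hab.ne hn (hH.anti ?_)
      refine sup_le hGH ?_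
      rw [SimpleGraph.edge_le_iff]
      exact Or.inr hab
    exact SimpleGraph.exists_of_maximal_cliqueFree_not_adj hM h hxy

open Finset in
/-- Lower bound on common non-neighbourhoods of non-adjacent vertices. -/
theorem aux_lower {V : Type} [Fintype V] [DecidableEq V] (G : SimpleGraph V)
    [DecidableRel G.Adj] (D : ℝ)
    (hD : ∀ x, ((univ.filter fun z => ¬ G.Adj x z).card : ℝ) ≤ D) (s : ℕ)
    (hk : ∀ j : ℕ, j < s + 1 → (0 : ℝ) < Fintype.card V - j * D)
    (hfree : G.CliqueFree (s + 2))
    (hmax : ∀ x y : V, x ≠ y → ¬ G.Adj x y →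
      ¬ (G ⊔ SimpleGraph.edge x y).CliqueFree (s + 2))
    (x y : V) (hxy : ¬ G.Adj x y) :
    (Fintype.card V : ℝ) - s * D ≤
      ((univ.filter fun z => ¬ G.Adj x z ∧ ¬ G.Adj y z).card : ℝ) := by
  obtain ⟨Q, hx, hy, hcx, hcy⟩ := aux_nonadj G D hD s hk hfree hmax x y hxy
  have hQ : Q.card = s := by
    have := hcx.card_eq
    rw [card_insert_of_notMem hx] at this
    omega
  have h1 := aux_common G D hD Q
  rw [hQ] at h1
  refine h1.trans ?_
  have hsub : (univ.filter fun z => ∀ q ∈ Q, G.Adj q z) ⊆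
      (univ.filter fun z => ¬ G.Adj x z ∧ ¬ G.Adj y z) := by
    intro z hz
    simp only [mem_filter, mem_univ, true_and] at hz ⊢
    have key : ∀ w, G.IsNClique (s + 1) (insert w Q) → ¬ G.Adj w z := by
      intro w hw hwz
      refine hfree _ (hw.insert (a := z) fun b hb => ?_)
      rcases mem_insert.mp hb with rfl | hb
      · exact hwz.symm
      · exact (hz b hb).symm
    exact ⟨key x hcx, key y hcy⟩
  exact_mod_cast card_le_card hsub

open Finset in
/-- Upper bound on common non-neighbourhoods of adjacent vertices. -/
theorem aux_upper {V : Type} [Fintype V] [DecidableEq V] (G : SimpleGraph V)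
    [DecidableRel G.Adj] (D : ℝ)
    (hD : ∀ x, ((univ.filter fun z => ¬ G.Adj x z).card : ℝ) ≤ D) (s : ℕ) (hs : 1 ≤ s)
    (hk : ∀ j : ℕ, j < s + 1 → (0 : ℝ) < Fintype.card V - j * D)
    (hfree : G.CliqueFree (s + 2))
    (x y : V) (hxy : G.Adj x y) :
    ((univ.filter fun z => ¬ G.Adj x z ∧ ¬ G.Adj y z).card : ℝ) ≤
      (s + 1) * D - Fintype.card V := by
  obtain ⟨K, hK, hc⟩ := aux_extend G D hD (s + 1) hk (s - 1) 2 (by omega) {x, y}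
    (by
      rw [SimpleGraph.isNClique_iff]
      refine ⟨?_, card_pair hxy.ne⟩
      simp [SimpleGraph.isClique_iff, Set.pairwise_insert, hxy, hxy.symm])
  have hx : x ∈ K := hK (by simp)
  have hy : y ∈ K.erase x := mem_erase.mpr ⟨hxy.ne.symm, hK (by simp)⟩
  set Q := (K.erase x).erase y with hQdef
  have hQ : Q.card = s - 1 := by
    rw [hQdef, card_erase_of_mem hy, card_erase_of_mem hx, hc.card_eq]; omega
  have h1 := aux_common G D hD Q
  rw [hQ, Nat.cast_sub hs] at h1
  have hsub : (univ.filter fun z => ∀ q ∈ Q, G.Adj q z) ⊆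
      (univ.filter fun z => ¬ G.Adj x z) ∪ (univ.filter fun z => ¬ G.Adj y z) := by
    intro z hz
    simp only [mem_filter, mem_univ, true_and, mem_union] at hz ⊢
    by_contra! h
    refine hfree _ (hc.insert (a := z) fun b hb => ?_)
    by_cases hbx : b = x
    · subst hbx; exact h.1.symm
    by_cases hby : b = y
    · subst hby; exact h.2.symm
    exact (hz b (mem_erase.mpr ⟨hby, mem_erase.mpr ⟨hbx, hb⟩⟩)).symm
  have h2 := card_le_card hsub
  have h3 := card_union_add_card_inter (univ.filter fun z => ¬ G.Adj x z)
    (univ.filter fun z => ¬ G.Adj y z)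
  rw [← filter_and] at h3
  have h2' : ((univ.filter fun z => ∀ q ∈ Q, G.Adj q z).card : ℝ) ≤
    (((univ.filter fun z => ¬ G.Adj x z) ∪ (univ.filter fun z => ¬ G.Adj y z)).card : ℝ) := by
    exact_mod_cast h2
  have h3' : (((univ.filter fun z => ¬ G.Adj x z) ∪
      (univ.filter fun z => ¬ G.Adj y z)).card : ℝ) +
      ((univ.filter fun z => ¬ G.Adj x z ∧ ¬ G.Adj y z).card : ℝ) =
      ((univ.filter fun z => ¬ G.Adj x z).card : ℝ) +
      ((univ.filter fun z => ¬ G.Adj y z).card : ℝ) := by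
    exact_mod_cast h3
  have := hD x
  have := hD y
  push_cast at h1
  linarith

open Finset in
/-- Almost-twins are twins. -/
theorem aux_twin {V : Type} [Fintype V] [DecidableEq V] [Nonempty V] (G : SimpleGraph V)
    [DecidableRel G.Adj] (τ ε : ℝ) (hε : 0 < ε)
    (hlow : ∀ x y, ¬ G.Adj x y → (τ + ε) * Fintype.card V ≤
      ((univ.filter fun z => ¬ G.Adj x z ∧ ¬ G.Adj y z).card : ℝ))
    (hupp : ∀ x y, G.Adj x y →
      ((univ.filter fun z => ¬ G.Adj x z ∧ ¬ G.Adj y z).card : ℝ) ≤ (τ - ε) * Fintype.card V)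
    (b b' : V) (W : Finset V) (hW : (W.card : ℝ) ≤ ε * Fintype.card V)
    (h : ∀ z, z ∉ W → (G.Adj b z ↔ G.Adj b' z)) (c : V) : G.Adj b c ↔ G.Adj b' c := by
  have hn : (0 : ℝ) < Fintype.card V := by exact_mod_cast Fintype.card_pos
  have key : ∀ b b' : V, (∀ z, z ∉ W → (G.Adj b z ↔ G.Adj b' z)) → G.Adj b' c → G.Adj b c := by
    intro b b' h h1
    by_contra h2
    have hl := hlow b c h2
    have hu := hupp b' c h1
    have hsub : (univ.filter fun z => ¬ G.Adj b z ∧ ¬ G.Adj c z) ⊆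
        (univ.filter fun z => ¬ G.Adj b' z ∧ ¬ G.Adj c z) ∪ W := by
      intro z hz
      simp only [mem_filter, mem_univ, true_and, mem_union] at hz ⊢
      by_cases hzW : z ∈ W
      · exact Or.inr hzW
      · exact Or.inl ⟨fun hh => hz.1 ((h z hzW).mpr hh), hz.2⟩
    have h3 := (card_le_card hsub).trans (card_union_le _ _)
    have h3' : ((univ.filter fun z => ¬ G.Adj b z ∧ ¬ G.Adj c z).card : ℝ) ≤
        ((univ.filter fun z => ¬ G.Adj b' z ∧ ¬ G.Adj c z).card : ℝ) + W.card := by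
      exact_mod_cast h3
    nlinarith [mul_pos hε hn]
  exact ⟨key b' b fun z hz => (h z hz).symm, key b b' h⟩

open Finset in
/-- A good sample exists: few misclassified pairs. -/
theorem aux_exists_sample {V : Type} [Fintype V] [DecidableEq V] [Nonempty V] (m : ℕ) (η : ℝ)
    (wrong : (Fin m → V) → V → V → Prop)
    (h : ∀ b c, ∀ P : Finset (Fin m → V), (∀ X ∈ P, wrong X b c) →
      (P.card : ℝ) ≤ η * (Fintype.card V : ℝ) ^ m) :
    ∃ X : Fin m → V, ∀ P : Finset (V × V), (∀ p ∈ P, wrong X p.1 p.2) →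
      (P.card : ℝ) ≤ η * (Fintype.card V : ℝ) ^ 2 := by
  classical
  have hn : (0 : ℝ) < Fintype.card V := by exact_mod_cast Fintype.card_pos
  have hsum : ∑ X : Fin m → V, ((univ.filter fun p : V × V => wrong X p.1 p.2).card : ℝ) ≤
      ∑ X : Fin m → V, η * (Fintype.card V : ℝ) ^ 2 := by
    have e1 : ∑ X : Fin m → V, ((univ.filter fun p : V × V => wrong X p.1 p.2).card : ℝ) =
        ∑ p : V × V, ((univ.filter fun X : Fin m → V => wrong X p.1 p.2).card : ℝ) := by
      simp only [card_filter, Nat.cast_sum]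
      rw [sum_comm]
    rw [e1]
    calc ∑ p : V × V, ((univ.filter fun X : Fin m → V => wrong X p.1 p.2).card : ℝ)
        ≤ ∑ p : V × V, η * (Fintype.card V : ℝ) ^ m :=
          sum_le_sum fun p _ => h p.1 p.2 _ (by simp)
      _ = _ := by simp; ring
  obtain ⟨X, -, hX⟩ := exists_le_of_sum_le (univ_nonempty) hsum
  refine ⟨X, fun P hP => le_trans ?_ hX⟩
  have : P ⊆ (univ.filter fun p : V × V => wrong X p.1 p.2) := by
    intro p hp; simpa using hP p hp
  exact_mod_cast card_le_card this

open Finset in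
/-- Bounded number of twin classes. -/
theorem aux_types {V : Type} [Fintype V] [DecidableEq V] [Nonempty V] (G : SimpleGraph V)
    [DecidableRel G.Adj] (τ ε : ℝ) (hε : 0 < ε) (m : ℕ)
    (hm : Real.exp (-(ε ^ 2 * m / 2)) ≤ (ε / 8) ^ 2)
    (hlow : ∀ x y, ¬ G.Adj x y → (τ + ε) * Fintype.card V ≤
      ((univ.filter fun z => ¬ G.Adj x z ∧ ¬ G.Adj y z).card : ℝ))
    (hupp : ∀ x y, G.Adj x y →
      ((univ.filter fun z => ¬ G.Adj x z ∧ ¬ G.Adj y z).card : ℝ) ≤ (τ - ε) * Fintype.card V) :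
    ∃ f : V → Finset (Finset (Fin m)), ∀ u v, f u = f v → ∀ c, G.Adj u c ↔ G.Adj v c := by
  classical
  have hn : (0 : ℝ) < Fintype.card V := by exact_mod_cast Fintype.card_pos
  let cnt : (Fin m → V) → V → V → ℝ := fun X b c =>
    ((univ.filter fun i => X i ∈ (univ.filter fun z => ¬ G.Adj b z ∧ ¬ G.Adj c z)).card : ℝ)
  let wrong : (Fin m → V) → V → V → Prop := fun X b c =>
    (G.Adj b c ∧ τ * m ≤ cnt X b c) ∨ (¬ G.Adj b c ∧ cnt X b c < τ * m)
  obtain ⟨X, hX⟩ := aux_exists_sample m (Real.exp (-(ε ^ 2 * m / 2))) wrong (by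
    intro b c P hP
    refine aux_sample m ε τ hε (univ.filter fun z => ¬ G.Adj b z ∧ ¬ G.Adj c z) P ?_
    by_cases hbc : G.Adj b c
    · refine Or.inl ⟨hupp b c hbc, fun X hXP => ?_⟩
      rcases hP X hXP with h | h
      · exact h.2
      · exact absurd hbc h.1
    · refine Or.inr ⟨hlow b c hbc, fun X hXP => ?_⟩
      rcases hP X hXP with h | h
      · exact absurd h.1 hbc
      · exact h.2)
  -- misclassified partners of a vertex
  let wr : V → Finset V := fun b => univ.filter fun c => wrong X b c
  let heavy : Finset V := univ.filter fun b => ε / 8 * Fintype.card V < ((wr b).card : ℝ)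
  have hheavy : (heavy.card : ℝ) ≤ ε / 8 * Fintype.card V := by
    have h1 := hX (heavy.sigma wr |>.map (Equiv.sigmaEquivProd V V).toEmbedding) (by
      intro p hp
      simp only [mem_map_equiv, mem_sigma] at hp
      exact (mem_filter.mp hp.2).2)
    rw [card_map, card_sigma] at h1
    have h2 : (heavy.card : ℝ) * (ε / 8 * Fintype.card V) ≤
        ((∑ b ∈ heavy, (wr b).card : ℕ) : ℝ) := by
      rw [← nsmul_eq_mul, ← sum_const]
      push_cast
      exact sum_le_sum fun b hb => (mem_filter.mp hb).2.le
    have h3 : (heavy.card : ℝ) * (ε / 8 * Fintype.card V) ≤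
        (ε / 8 * Fintype.card V) * (ε / 8 * Fintype.card V) := by
      refine (h2.trans h1).trans ?_
      calc Real.exp (-(ε ^ 2 * m / 2)) * (Fintype.card V : ℝ) ^ 2
          ≤ (ε / 8) ^ 2 * (Fintype.card V : ℝ) ^ 2 := by gcongr
        _ = _ := by ring
    exact le_of_mul_le_mul_right h3 (by positivity)
  let tr : V → Finset (Fin m) := fun b => univ.filter fun i => ¬ G.Adj b (X i)
  have hcnt : ∀ b b' c, tr b = tr b' → cnt X b c = cnt X b' c := by
    intro b b' c h
    have h1 : ∀ i, (¬ G.Adj b (X i) ↔ ¬ G.Adj b' (X i)) := by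
      intro i
      have := Finset.ext_iff.mp h i
      simpa only [tr, mem_filter, mem_univ, true_and] using this
    simp only [cnt, mem_filter, mem_univ, true_and, h1]
  have hlight : ∀ b b', b ∉ heavy → b' ∉ heavy → tr b = tr b' →
      ∀ c, G.Adj b c ↔ G.Adj b' c := by
    intro b b' hb hb' h
    simp only [heavy, mem_filter, mem_univ, true_and, not_lt] at hb hb'
    refine aux_twin G τ ε hε hlow hupp b b' (wr b ∪ wr b') ?_ ?_
    · have : ((wr b ∪ wr b').card : ℝ) ≤ (wr b).card + (wr b').card := by
        exact_mod_cast card_union_le _ _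
      nlinarith [mul_pos hε hn]
    · intro z hz
      simp only [wr, wrong, mem_union, mem_filter, mem_univ, true_and] at hz
      rw [hcnt b b' z h] at hz
      push Not at hz
      obtain ⟨⟨h1, h2⟩, h3, h4⟩ := hz
      constructor
      · intro hh
        by_contra hc
        exact absurd (h1 hh) (not_lt.mpr (h4 hc))
      · intro hh
        by_contra hc
        exact absurd (h3 hh) (not_lt.mpr (h2 hc))
  refine ⟨fun v => (univ.filter fun c => c ∉ heavy ∧ G.Adj v c).image tr, ?_⟩
  intro u v huv
  have key : ∀ u v : V, (univ.filter fun c => c ∉ heavy ∧ G.Adj u c).image tr =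
      (univ.filter fun c => c ∉ heavy ∧ G.Adj v c).image tr →
      ∀ z, z ∉ heavy → G.Adj u z → G.Adj v z := by
    intro u v huv z hz huz
    have h1 : tr z ∈ (univ.filter fun c => c ∉ heavy ∧ G.Adj v c).image tr := by
      rw [← huv]
      exact mem_image_of_mem _ (by simp [hz, huz])
    obtain ⟨z', hz', he⟩ := mem_image.mp h1
    simp only [mem_filter, mem_univ, true_and] at hz'
    exact ((hlight z' z hz'.1 hz he v).mp hz'.2.symm).symm
  refine aux_twin G τ ε hε hlow hupp u v heavy ?_ ?_
  · nlinarith [mul_pos hε hn]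
  · exact fun z hz => ⟨key u v huv z hz, key v u huv.symm z hz⟩

/-- For `r ≥ 3`, `ε > 0`, `m = ⌈4 ln(8/ε)/ε²⌉ + 1`, `T = 2^m` and `L = 2^T + T`:
for every `n > L` and every maximal `K_r`-free graph `G` on `n` vertices with minimum
degree at least `((2r-5)/(2r-3) + ε) * n`, there is a `K_r`-free graph `H` on at most
`L` vertices such that `G` admits a homomorphism into `H`. -/
theorem hom_image_of_maximal_cliquefree (r : ℕ) (hr : 3 ≤ r) (ε : ℝ) (hε : 0 < ε)
    (m T L : ℕ) (hm : m = ⌈4 * Real.log (8 / ε) / ε ^ 2⌉₊ + 1)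
    (hT : T = 2 ^ m) (hL : L = 2 ^ T + T)
    (V : Type) [Fintype V] (hn : L < Fintype.card V)
    (G : SimpleGraph V) [DecidableRel G.Adj]
    (hfree : G.CliqueFree r)
    (hmax : ∀ x y : V, x ≠ y → ¬ G.Adj x y →
      ¬ (G ⊔ SimpleGraph.edge x y).CliqueFree r)
    (hδ : ((2 * (r : ℝ) - 5) / (2 * (r : ℝ) - 3) + ε) * Fintype.card V ≤ G.minDegree) :
    ∃ (k : ℕ) (H : SimpleGraph (Fin k)),
      k ≤ L ∧ H.CliqueFree r ∧ Nonempty (G →g H) := by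
  classical
  have : Nonempty V := Fintype.card_pos_iff.mp (by omega)
  have hn0 : (0 : ℝ) < Fintype.card V := by exact_mod_cast Fintype.card_pos
  obtain ⟨s, rfl⟩ : ∃ s, r = s + 2 := ⟨r - 2, by omega⟩
  have hs : 1 ≤ s := by omega
  have hs' : (1 : ℝ) ≤ s := by exact_mod_cast hs
  -- `τ = 1 / (2 r - 3)`
  obtain ⟨τ, hτ⟩ : ∃ τ : ℝ, τ = 1 / (2 * (s : ℝ) + 1) := ⟨_, rfl⟩
  have hτ1 : (2 * (s : ℝ) + 1) * τ = 1 := by rw [hτ]; field_simp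
  have hτ0 : 0 < τ := by rw [hτ]; positivity
  have hfrac : (2 * ((s + 2 : ℕ) : ℝ) - 5) / (2 * ((s + 2 : ℕ) : ℝ) - 3) = 1 - 2 * τ := by
    rw [hτ]
    have h1 : (2 * ((s + 2 : ℕ) : ℝ) - 3) = 2 * s + 1 := by push_cast; ring
    rw [h1]
    push_cast
    field_simp
    ring
  rw [hfrac] at hδ
  have hD : ∀ x, ((Finset.univ.filter fun z => ¬ G.Adj x z).card : ℝ) ≤
      (2 * τ - ε) * Fintype.card V := by
    intro x
    have h1 : (G.minDegree : ℝ) ≤ G.degree x := by exact_mod_cast G.minDegree_le_degree x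
    have h2 := Finset.card_filter_add_card_filter_not (s := (Finset.univ : Finset V))
      (fun z => G.Adj x z)
    rw [← SimpleGraph.neighborFinset_eq_filter, SimpleGraph.card_neighborFinset_eq_degree,
      Finset.card_univ] at h2
    have h3 : (G.degree x : ℝ) + ((Finset.univ.filter fun z => ¬ G.Adj x z).card : ℝ) =
      Fintype.card V := by exact_mod_cast h2
    linarith
  have hk : ∀ j : ℕ, j < s + 1 →
      (0 : ℝ) < Fintype.card V - j * ((2 * τ - ε) * Fintype.card V) := by
    intro j hj
    have hj' : (j : ℝ) ≤ s := by exact_mod_cast Nat.lt_succ_iff.mp hj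
    have hj0 : (0 : ℝ) ≤ j := by positivity
    have h1 : j * (2 * τ - ε) < 1 := by nlinarith
    nlinarith
  have hlow : ∀ x y, ¬ G.Adj x y → (τ + ε) * Fintype.card V ≤
      ((Finset.univ.filter fun z => ¬ G.Adj x z ∧ ¬ G.Adj y z).card : ℝ) := by
    intro x y hxy
    refine le_trans ?_ (aux_lower G _ hD s hk hfree hmax x y hxy)
    have h1 : τ + ε ≤ 1 - s * (2 * τ - ε) := by nlinarith
    nlinarith
  have hupp : ∀ x y, G.Adj x y →
      ((Finset.univ.filter fun z => ¬ G.Adj x z ∧ ¬ G.Adj y z).card : ℝ) ≤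
        (τ - ε) * Fintype.card V := by
    intro x y hxy
    refine (aux_upper G _ hD s hs hk hfree x y hxy).trans ?_
    have h1 : (s + 1) * (2 * τ - ε) - 1 ≤ τ - ε := by nlinarith
    nlinarith
  have hexp : Real.exp (-(ε ^ 2 * m / 2)) ≤ (ε / 8) ^ 2 := by
    have h1 : 4 * Real.log (8 / ε) / ε ^ 2 ≤ m := by
      rw [hm]
      push_cast
      have := Nat.le_ceil (4 * Real.log (8 / ε) / ε ^ 2)
      linarith
    have h2 : 4 * Real.log (8 / ε) ≤ m * ε ^ 2 := by
      rwa [div_le_iff₀ (by positivity)] at h1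
    have h3 : Real.log (8 / ε) = - Real.log (ε / 8) := by
      rw [← Real.log_inv, inv_div]
    have h4 : (ε / 8) ^ 2 = Real.exp (2 * Real.log (ε / 8)) := by
      rw [two_mul, Real.exp_add, Real.exp_log (by positivity)]
      ring
    rw [h4]
    apply Real.exp_le_exp.mpr
    linarith
  obtain ⟨f, hf⟩ := aux_types G τ ε hε m hexp hlow hupp
  -- representatives of the twin classes
  let e : Set.range f ≃ Fin (Fintype.card (Set.range f)) := Fintype.equivFin _
  let g : Fin (Fintype.card (Set.range f)) → V := fun i => (e.symm i).2.choose
  have hg : ∀ i, f (g i) = (e.symm i : Finset (Finset (Fin m))) :=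
    fun i => (e.symm i).2.choose_spec
  have hginj : Function.Injective g := by
    intro i j hij
    apply e.symm.injective
    apply Subtype.ext
    rw [← hg i, ← hg j, hij]
  refine ⟨Fintype.card (Set.range f), G.comap g, ?_, ?_, ⟨⟨fun v => e ⟨f v, v, rfl⟩, ?_⟩⟩⟩
  · have h1 : Fintype.card (Set.range f) ≤ Fintype.card (Finset (Finset (Fin m))) :=
      Fintype.card_subtype_le _
    rw [Fintype.card_finset, Fintype.card_finset, Fintype.card_fin, ← hT] at h1
    omega
  · exact hfree.comap ⟨(SimpleGraph.Embedding.comap ⟨g, hginj⟩ G).toCopy⟩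
  · intro u v huv
    have hu : f (g (e ⟨f u, u, rfl⟩)) = f u := by rw [hg]; simp
    have hv : f (g (e ⟨f v, v, rfl⟩)) = f v := by rw [hg]; simp
    rw [SimpleGraph.comap_adj, hf _ _ hu, SimpleGraph.adj_comm, hf _ _ hv]
    exact huv.symm
end

section
/- Let r ≥ 3 be an integer and ε > 0 a real number, and set m = ⌈4 ln(8/ε)/ε²⌉ + 1, T = 2^m and L = 2^T + T. Then for every n > L, every maximal K_r-free graph G on n vertices with minimum degree δ(G) ≥ ((2r-5)/(2r-3) + ε)·n admits a partition of its vertex set into at most L independent sets such that for any two distinct parts A and B of the partition, either every pair (a,b) with a ∈ A, b ∈ B is an edge of G, or no such pair is an edge of G; in other words, G is a blow-up of a K_r-free graph on at most L vertices. -/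
open Finset

namespace BlowupAux

variable {V : Type} [Fintype V] [DecidableEq V] {G : SimpleGraph V}

/-- Averaging lemma: a vertex outside the exceptional set is adjacent to everything in `A` and
misses at most one element of `B`. -/
lemma averaging {I W : Type*} [Fintype I] [DecidableEq I] [DecidableEq W] (R : I → W → Prop)
    (S : Finset I) (k : ℕ) (d : ℝ)
    (hd : d = (2 * (k + 3 : ℝ) - 5) / (2 * (k + 3 : ℝ) - 3))
    (A B : Finset W)
    (hdeg : ∀ a ∈ A ∪ B, d * Fintype.card I + 2 * (#S : ℝ) <
      (Nat.card {i // R i a} : ℝ))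
    (hW : 2 * #A + #B ≤ 2 * k + 3) (hne : (A ∪ B).Nonempty) :
    ∃ x, x ∉ S ∧ (∀ a ∈ A, R x a) ∧ ∀ b ∈ B, ∀ b' ∈ B, b ≠ b' → R x b ∨ R x b' := by
  classical
  by_contra hcon
  push Not at hcon
  have key : ∀ x, x ∉ S → (2 : ℝ) ≤ 2 * (∑ a ∈ A, if R x a then 0 else 1)
      + ∑ b ∈ B, if R x b then (0 : ℝ) else 1 := by
    intro x hx
    have nnA : ∀ C : Finset W, (0 : ℝ) ≤ ∑ a ∈ C, if R x a then (0 : ℝ) else 1 := by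
      intro C
      apply Finset.sum_nonneg
      intros; split_ifs <;> norm_num
    by_cases hA : ∀ a ∈ A, R x a
    · obtain ⟨b, hb, b', hb', hbb, h1, h2⟩ := hcon x hx hA
      have : ∑ c ∈ ({b, b'} : Finset W), (if R x c then (0 : ℝ) else 1) ≤
          ∑ c ∈ B, if R x c then (0 : ℝ) else 1 := by
        apply Finset.sum_le_sum_of_subset_of_nonneg
        · intro c hc
          simp only [Finset.mem_insert, Finset.mem_singleton] at hc
          rcases hc with rfl | rfl <;> assumption
        · intros; split_ifs <;> norm_num
      rw [Finset.sum_pair hbb, if_neg h1, if_neg h2] at this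
      have := nnA A
      linarith
    · push Not at hA
      obtain ⟨a, ha, hna⟩ := hA
      have : (if R x a then (0 : ℝ) else 1) ≤ ∑ a ∈ A, if R x a then (0 : ℝ) else 1 := by
        apply Finset.single_le_sum (f := fun a => if R x a then (0 : ℝ) else 1) _ ha
        intros; split_ifs <;> norm_num
      rw [if_neg hna] at this
      have := nnA B
      linarith
  have tot : (2 : ℝ) * (Fintype.card I - #S) ≤ ∑ x : I, (2 * (∑ a ∈ A, if R x a then 0 else 1)
      + ∑ b ∈ B, if R x b then (0 : ℝ) else 1) := by
    calc (2 : ℝ) * (Fintype.card I - #S) = ∑ x ∈ Sᶜ, (2 : ℝ) := by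
          rw [Finset.sum_const, Finset.card_compl, nsmul_eq_mul, Nat.cast_sub (Finset.card_le_univ S)]
          ring
      _ ≤ ∑ x ∈ Sᶜ, (2 * (∑ a ∈ A, if R x a then 0 else 1)
            + ∑ b ∈ B, if R x b then (0 : ℝ) else 1) := by
          apply Finset.sum_le_sum
          intro x hx
          exact key x (Finset.mem_compl.mp hx)
      _ ≤ _ := by
          apply Finset.sum_le_sum_of_subset_of_nonneg (Finset.subset_univ _)
          intro x _ _
          have : ∀ C : Finset W, (0 : ℝ) ≤ ∑ a ∈ C, if R x a then (0 : ℝ) else 1 := by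
            intro C
            apply Finset.sum_nonneg
            intros; split_ifs <;> norm_num
          have h1 := this A
          have h2 := this B
          linarith
  rw [Finset.sum_add_distrib, ← Finset.mul_sum, Finset.sum_comm, Finset.sum_comm (t := B)] at tot
  set θ : ℝ := 2 / (2 * k + 3) * Fintype.card I - 2 * #S with hθ
  have hk : (0 : ℝ) < 2 * k + 3 := by positivity
  have hd' : d = 1 - 2 / (2 * k + 3) := by
    rw [hd]
    have : (2 * (k + 3 : ℝ) - 3) = 2 * k + 3 := by ring
    rw [this]
    field_simp
    ring
  have col : ∀ a ∈ A ∪ B, ∑ x : I, (if R x a then (0 : ℝ) else 1) < θ := by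
    intro a ha
    have h1 := hdeg a ha
    have h2 : ∑ x : I, (if R x a then (0 : ℝ) else 1) + Nat.card {i // R i a} = Fintype.card I := by
      rw [Nat.card_eq_fintype_card, Fintype.card_subtype, Finset.card_filter]
      push_cast
      rw [← Finset.sum_add_distrib]
      have : ∀ x : I, (if R x a then (0 : ℝ) else 1) + (if R x a then 1 else 0) = 1 := by
        intro x; split_ifs <;> norm_num
      simp [this]
    rw [hd'] at h1
    rw [hθ]
    linarith
  have colA : ∑ a ∈ A, ∑ x : I, (if R x a then (0 : ℝ) else 1) ≤ #A * θ := by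
    rw [← nsmul_eq_mul]
    exact Finset.sum_le_card_nsmul _ _ _ fun a ha => (col a (Finset.mem_union_left _ ha)).le
  have colB : ∑ a ∈ B, ∑ x : I, (if R x a then (0 : ℝ) else 1) ≤ #B * θ := by
    rw [← nsmul_eq_mul]
    exact Finset.sum_le_card_nsmul _ _ _ fun a ha => (col a (Finset.mem_union_right _ ha)).le
  have strict : (2 : ℝ) * (∑ a ∈ A, ∑ x : I, (if R x a then (0 : ℝ) else 1)) +
      ∑ a ∈ B, ∑ x : I, (if R x a then (0 : ℝ) else 1) < (2 * #A + #B) * θ := by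
    rcases Finset.union_nonempty.mp hne with h | h
    · have : ∑ a ∈ A, ∑ x : I, (if R x a then (0 : ℝ) else 1) < #A * θ := by
        rw [← nsmul_eq_mul, ← Finset.sum_const]
        exact Finset.sum_lt_sum_of_nonempty h fun a ha => (col a (Finset.mem_union_left _ ha))
      linarith
    · have : ∑ a ∈ B, ∑ x : I, (if R x a then (0 : ℝ) else 1) < #B * θ := by
        rw [← nsmul_eq_mul, ← Finset.sum_const]
        exact Finset.sum_lt_sum_of_nonempty h fun a ha => (col a (Finset.mem_union_right _ ha))
      linarith
  have hW' : (2 * #A + #B : ℝ) ≤ 2 * k + 3 := by exact_mod_cast hW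
  have hW1 : (1 : ℝ) ≤ 2 * #A + #B := by
    have : 1 ≤ 2 * #A + #B := by
      have := Finset.card_pos.mpr hne
      have := Finset.card_union_le A B
      omega
    exact_mod_cast this
  have e1 : (2 * #A + #B : ℝ) * (2 / (2 * k + 3) * Fintype.card I) ≤ 2 * Fintype.card I := by
    calc _ ≤ (2 * k + 3 : ℝ) * (2 / (2 * k + 3) * Fintype.card I) := by gcongr
      _ = _ := by field_simp
  have e2 : (2 * #S : ℝ) ≤ (2 * #A + #B : ℝ) * (2 * #S) :=
    le_mul_of_one_le_left (by positivity) hW1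
  have e3 : (2 * #A + #B : ℝ) * θ = (2 * #A + #B : ℝ) * (2 / (2 * k + 3) * Fintype.card I)
      - (2 * #A + #B : ℝ) * (2 * #S) := by rw [hθ]; ring
  linarith

/-- A `k`-clique completely joined to a triangle is impossible in a `K_{k+3}`-free graph. -/
lemma no_join {k : ℕ} (hfree : G.CliqueFree (k + 3)) {A : Finset V} (hA : G.IsNClique k A)
    {a b c : V} (ha : ∀ x ∈ A, G.Adj a x) (hb : ∀ x ∈ A, G.Adj b x) (hc : ∀ x ∈ A, G.Adj c x)
    (hab : G.Adj a b) (hac : G.Adj a c) (hbc : G.Adj b c) : False := by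
  refine hfree _ (((hA.insert hc).insert (a := b) ?_).insert (a := a) ?_)
  · intro x hx
    rcases Finset.mem_insert.mp hx with rfl | hx
    · exact hbc
    · exact hb x hx
  · intro x hx
    rcases Finset.mem_insert.mp hx with rfl | hx
    · exact hab
    rcases Finset.mem_insert.mp hx with rfl | hx
    · exact hac
    · exact ha x hx

/-- The property provided by averaging on `V`. -/
def Avg (G : SimpleGraph V) (k : ℕ) (g : V → Prop) : Prop :=
  ∀ A B : Finset V, 2 * #A + #B ≤ 2 * k + 3 → (A ∪ B).Nonempty →
    ∃ x, g x ∧ (∀ a ∈ A, G.Adj x a) ∧ ∀ b ∈ B, ∀ b' ∈ B, b ≠ b' → G.Adj x b ∨ G.Adj x b'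

/-- The property that makes `u` and `v` twins. -/
def Sim (G : SimpleGraph V) (k : ℕ) (P : V → Prop) (u v : V) : Prop :=
  ∀ A B : Finset V, (∀ a ∈ A ∪ B, P a) → 2 * #A + #B ≤ 2 * k + 3 → (A ∪ B).Nonempty →
    ∃ x, (G.Adj x u ↔ G.Adj x v) ∧ (∀ a ∈ A, G.Adj x a) ∧
      ∀ b ∈ B, ∀ b' ∈ B, b ≠ b' → G.Adj x b ∨ G.Adj x b'

lemma extend {k : ℕ} {g : V → Prop} (hV : Avg G k g) {u v : V} (huv : G.Adj u v) :
    ∀ j ≤ k, ∃ A : Finset V, G.IsNClique j A ∧ (∀ a ∈ A, g a ∧ G.Adj u a ∧ G.Adj v a) := by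
  intro j
  induction j with
  | zero => intro _; exact ⟨∅, by simp [SimpleGraph.isNClique_empty], by simp⟩
  | succ j ih =>
    intro hj
    obtain ⟨A, hA, hg⟩ := ih (by omega)
    obtain ⟨x, hx, hxa, -⟩ := hV (insert u (insert v A)) ∅ (by
      have h1 := Finset.card_insert_le v A
      have h2 := Finset.card_insert_le u (insert v A)
      have := hA.card_eq
      simp only [Finset.card_empty]
      omega) (by simp)
    refine ⟨insert x A, hA.insert fun b hb => hxa b (by simp [hb]), ?_⟩
    intro a ha
    rcases Finset.mem_insert.mp ha with rfl | ha
    · exact ⟨hx, (hxa u (by simp)).symm, (hxa v (by simp)).symm⟩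
    · exact hg a ha

lemma sim_not_adj {k : ℕ} (hfree : G.CliqueFree (k + 3)) {g P : V → Prop} (hV : Avg G k g)
    (hgP : ∀ x, g x → P x) {u v : V} (hu : P u) (hs : Sim G k P u v) : ¬ G.Adj u v := by
  intro huv
  obtain ⟨A, hA, hg⟩ := extend hV huv k le_rfl
  obtain ⟨x, hiff, hxa, -⟩ := hs (insert u A) ∅ (by
      intro a ha
      simp only [Finset.union_empty, Finset.mem_insert] at ha
      rcases ha with rfl | ha
      · exact hu
      · exact hgP _ (hg a ha).1) (by
      have h1 := Finset.card_insert_le u A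
      have := hA.card_eq
      simp only [Finset.card_empty]
      omega) (by simp)
  have hxu := hxa u (by simp)
  exact no_join hfree hA (a := x) (b := u) (c := v) (fun y hy => hxa y (by simp [hy]))
    (fun y hy => (hg y hy).2.1) (fun y hy => (hg y hy).2.2) hxu (hiff.mp hxu) huv

lemma core {k : ℕ} (hfree : G.CliqueFree (k + 3)) {P : V → Prop}
    {u v : V} (hu : P u) (hs : Sim G k P u v) (hna : ¬ G.Adj u v)
    {A : Finset V} (hA : G.IsNClique k A) (hPA : ∀ a ∈ A, P a) {w z : V} (hw : P w) (hz : P z)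
    (hwz : G.Adj w z) (huw : G.Adj u w) (hvz : G.Adj v z)
    (hAw : ∀ a ∈ A, G.Adj w a) (hAz : ∀ a ∈ A, G.Adj z a) (hAu : ∀ a ∈ A, G.Adj u a)
    (hAv : ∀ a ∈ A, G.Adj v a) : False := by
  obtain ⟨x, hiff, hxa, hxb⟩ := hs A {u, w, z} (by
      intro a ha
      simp only [Finset.mem_union, Finset.mem_insert, Finset.mem_singleton] at ha
      rcases ha with ha | rfl | rfl | rfl
      · exact hPA _ ha
      all_goals assumption) (by
      have := Finset.card_le_three (a := u) (b := w) (c := z)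
      have := hA.card_eq
      omega) (by simp)
  have huz : u ≠ z := by rintro rfl; exact hna hvz.symm
  have h1 := hxb u (by simp) w (by simp) huw.ne
  have h2 := hxb u (by simp) z (by simp) huz
  have h3 := hxb w (by simp) z (by simp) hwz.ne
  by_cases hxw : G.Adj x w
  · rcases h2 with h2 | h2
    · exact no_join hfree hA hxa hAu hAw h2 hxw huw
    · exact no_join hfree hA hxa hAw hAz hxw h2 hwz
  · have hxu : G.Adj x u := by tauto
    have hxz : G.Adj x z := by tauto
    exact no_join hfree hA hxa hAv hAz (hiff.mp hxu) hxz hvz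

lemma reduce {k : ℕ} (hfree : G.CliqueFree (k + 3)) {g : V → Prop} (hV : Avg G k g) {u v : V}
    (hna : ¬ G.Adj u v) :
    ∀ (n : ℕ) (K : Finset V), G.IsNClique (k + 2) K → (∀ x ∈ K, G.Adj u x ∨ G.Adj v x) →
      (∃ F : Finset V, (∀ x, x ∈ F ↔ x ∈ K ∧ ¬ (G.Adj u x ∧ G.Adj v x)) ∧ #F = n) →
      ∃ (A : Finset V) (w z : V), G.IsNClique k A ∧ (∀ a ∈ A, G.Adj w a) ∧ (∀ a ∈ A, G.Adj z a) ∧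
        (∀ a ∈ A, G.Adj u a) ∧ (∀ a ∈ A, G.Adj v a) ∧ G.Adj w z ∧ G.Adj u w ∧ G.Adj v z ∧
        ∀ x ∈ insert w (insert z A), x ∈ K ∨ g x := by
  intro n
  induction n with
  | zero =>
    rintro K hK hKuv ⟨F, hF, hFn⟩
    exfalso
    rw [Finset.card_eq_zero] at hFn
    subst hFn
    refine hfree _ (hK.insert (a := u) fun b hb => ?_)
    by_contra h
    have := (hF b).mpr ⟨hb, fun h' => h h'.1⟩
    simp at this
  | succ n ih =>
    rintro K hK hKuv ⟨F, hF, hFn⟩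
    have hFK : F ⊆ K := fun x hx => ((hF x).mp hx).1
    obtain ⟨p, hp, hvp⟩ : ∃ p ∈ K, ¬ G.Adj v p := by
      by_contra h
      push Not at h
      exact hfree _ (hK.insert (a := v) h)
    obtain ⟨q, hq, huq⟩ : ∃ q ∈ K, ¬ G.Adj u q := by
      by_contra h
      push Not at h
      exact hfree _ (hK.insert (a := u) h)
    have hup : G.Adj u p := by have := hKuv p hp; tauto
    have hvq : G.Adj v q := by have := hKuv q hq; tauto
    have hpq : p ≠ q := by rintro rfl; exact hvp hvq
    have hcl : ∀ x ∈ K, ∀ y ∈ K, x ≠ y → G.Adj x y := fun x hx y hy h =>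
      hK.isClique (Finset.mem_coe.mpr hx) (Finset.mem_coe.mpr hy) h
    by_cases hn : n + 1 ≤ 2
    · have hall : ∀ a ∈ (K.erase p).erase q, a ∈ K ∧ a ≠ p ∧ a ≠ q ∧ G.Adj u a ∧ G.Adj v a := by
        intro a ha
        simp only [Finset.mem_erase] at ha
        obtain ⟨haq, hap, haK⟩ := ha
        by_contra hcon
        have haF : a ∈ F := (hF a).mpr ⟨haK, by tauto⟩
        have : ({a, p, q} : Finset V) ⊆ F := by
          intro y hy
          simp only [Finset.mem_insert, Finset.mem_singleton] at hy
          rcases hy with rfl | rfl | rfl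
          · exact haF
          · exact (hF _).mpr ⟨hp, by tauto⟩
          · exact (hF _).mpr ⟨hq, by tauto⟩
        have h3 := Finset.card_le_card this
        rw [Finset.card_eq_three.mpr ⟨a, p, q, hap, haq, hpq, rfl⟩] at h3
        omega
      refine ⟨(K.erase p).erase q, p, q, ⟨?_, ?_⟩, ?_, ?_, ?_, ?_, hcl p hp q hq hpq, hup, hvq, ?_⟩
      · refine hK.isClique.subset ?_
        intro x hx
        exact (hall x hx).1
      · rw [Finset.card_erase_of_mem (by simp [hq, hpq.symm]), Finset.card_erase_of_mem hp,
          hK.card_eq]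
        omega
      · intro a ha
        obtain ⟨h1, h2, h3, h4, h5⟩ := hall a ha
        exact hcl p hp a h1 h2.symm
      · intro a ha
        obtain ⟨h1, h2, h3, h4, h5⟩ := hall a ha
        exact hcl q hq a h1 h3.symm
      · intro a ha
        exact (hall a ha).2.2.2.1
      · intro a ha
        exact (hall a ha).2.2.2.2
      · intro x hx
        left
        simp only [Finset.mem_insert] at hx
        rcases hx with rfl | rfl | hx
        · exact hp
        · exact hq
        · exact (hall x hx).1
    · obtain ⟨x, hgx, hxA, hxB⟩ := hV (K \ F) (insert u (insert v F)) (by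
        have h1 := Finset.card_insert_le v F
        have h2 := Finset.card_insert_le u (insert v F)
        have h3 := Finset.card_sdiff_of_subset hFK
        have h4 := hK.card_eq
        have h5 := Finset.card_le_card hFK
        omega) (by simp)
      have huv : u ≠ v := by rintro rfl; exact huq hvq
      have hxuv := hxB u (by simp) v (by simp) huv
      -- x misses some element of K
      obtain ⟨y, hy, hxy⟩ : ∃ y ∈ K, ¬ G.Adj x y := by
        by_contra h
        push Not at h
        exact hfree _ (hK.insert (a := x) h)
      have hyF : y ∈ F := by
        by_contra h
        exact hxy (hxA y (by simp [hy, h]))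
      have hynot := ((hF y).mp hyF).2
      have hxrest : ∀ a ∈ K, a ≠ y → G.Adj x a := by
        intro a ha hay
        by_cases haF : a ∈ F
        · have := hxB a (by simp [haF]) y (by simp [hyF]) hay
          tauto
        · exact hxA a (by simp [ha, haF])
      have hyu : u ≠ y := by
        rintro rfl
        rcases hKuv u hy with h | h
        · exact G.loopless.irrefl u h
        · exact hna h.symm
      have hyv : v ≠ y := by
        rintro rfl
        rcases hKuv v hy with h | h
        · exact hna h
        · exact G.loopless.irrefl v h
      have hxu : G.Adj x u := by
        have := hxB u (by simp) y (by simp [hyF]) hyu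
        tauto
      have hxv : G.Adj x v := by
        have := hxB v (by simp) y (by simp [hyF]) hyv
        tauto
      have hxney : x ≠ y := by
        rintro rfl
        exact hynot ⟨hxu.symm, hxv.symm⟩
      have hxK : x ∉ K := fun h => G.loopless.irrefl x (hxrest x h hxney)
      have hK' : G.IsNClique (k + 2) (insert x (K.erase y)) := by
        have h1 : G.IsNClique (k + 1) (K.erase y) := by
          refine ⟨hK.isClique.subset (by intro a ha; exact Finset.mem_of_mem_erase ha), ?_⟩
          rw [Finset.card_erase_of_mem hy, hK.card_eq]
          omega
        exact h1.insert fun b hb => hxrest b (Finset.mem_of_mem_erase hb) (Finset.ne_of_mem_erase hb)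
      obtain ⟨A, w, z, h1, h2, h3, h4, h5, h6, h7, h8, h9⟩ := ih (insert x (K.erase y)) hK' (by
        intro a ha
        rcases Finset.mem_insert.mp ha with rfl | ha
        · exact Or.inl hxu.symm
        · exact hKuv a (Finset.mem_of_mem_erase ha)) ⟨F.erase y, by
          intro a
          simp only [Finset.mem_erase, Finset.mem_insert, hF]
          constructor
          · rintro ⟨h1, h2, h3⟩
            exact ⟨Or.inr ⟨h1, h2⟩, h3⟩
          · rintro ⟨rfl | ⟨h1, h2⟩, h3⟩
            · exact absurd ⟨hxu.symm, hxv.symm⟩ h3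
            · exact ⟨h1, h2, h3⟩, by
          rw [Finset.card_erase_of_mem hyF, hFn]; rfl⟩
      refine ⟨A, w, z, h1, h2, h3, h4, h5, h6, h7, h8, ?_⟩
      intro a ha
      rcases h9 a ha with h | h
      · rcases Finset.mem_insert.mp h with rfl | h
        · exact Or.inr hgx
        · exact Or.inl (Finset.mem_of_mem_erase h)
      · exact Or.inr h

/-- Maximality gives a common `(k+1)`-clique for nonadjacent vertices. -/
lemma common_clique {k : ℕ} (hfree : G.CliqueFree (k + 3))
    (hmax : ∀ x y : V, x ≠ y → ¬ G.Adj x y → ¬ (G ⊔ SimpleGraph.edge x y).CliqueFree (k + 3))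
    {v w : V} (hvw : v ≠ w) (hna : ¬ G.Adj v w) :
    ∃ Z : Finset V, G.IsNClique (k + 1) Z ∧ (∀ z ∈ Z, G.Adj v z) ∧ ∀ z ∈ Z, G.Adj w z := by
  have h := hmax v w hvw hna
  unfold SimpleGraph.CliqueFree at h
  push Not at h
  obtain ⟨s, hs⟩ := h
  have hadj : ∀ a ∈ s, ∀ b ∈ s, a ≠ b → G.Adj a b ∨ (a = v ∧ b = w) ∨ (a = w ∧ b = v) := by
    intro a ha b hb hab
    have := hs.isClique (Finset.mem_coe.mpr ha) (Finset.mem_coe.mpr hb) hab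
    rw [SimpleGraph.sup_adj, SimpleGraph.edge_adj] at this
    tauto
  have hv : v ∈ s := by
    by_contra hv
    refine hfree s ⟨?_, hs.card_eq⟩
    intro a ha b hb hab
    rcases hadj a ha b hb hab with h | ⟨rfl, rfl⟩ | ⟨rfl, rfl⟩
    · exact h
    · exact absurd ha hv
    · exact absurd hb hv
  have hw : w ∈ s := by
    by_contra hw
    refine hfree s ⟨?_, hs.card_eq⟩
    intro a ha b hb hab
    rcases hadj a ha b hb hab with h | ⟨rfl, rfl⟩ | ⟨rfl, rfl⟩
    · exact h
    · exact absurd hb hw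
    · exact absurd ha hw
  have hmem : ∀ z ∈ (s.erase v).erase w, z ∈ s ∧ z ≠ v ∧ z ≠ w := by
    intro z hz
    simp only [Finset.mem_erase] at hz
    tauto
  refine ⟨(s.erase v).erase w, ⟨?_, ?_⟩, ?_, ?_⟩
  · intro a ha b hb hab
    obtain ⟨h1, h2, h3⟩ := hmem a ha
    obtain ⟨h4, h5, h6⟩ := hmem b hb
    have := hadj a h1 b h4 hab
    tauto
  · rw [Finset.card_erase_of_mem (by simp [hw, hvw.symm]), Finset.card_erase_of_mem hv, hs.card_eq]
    omega
  · intro a ha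
    obtain ⟨h1, h2, h3⟩ := hmem a ha
    have := hadj v hv a h1 h2.symm
    tauto
  · intro a ha
    obtain ⟨h1, h2, h3⟩ := hmem a ha
    have := hadj w hw a h1 h3.symm
    tauto

/-- The common clique can be taken to consist of good vertices. -/
lemma good_clique {k : ℕ} (hfree : G.CliqueFree (k + 3)) {g : V → Prop} (hV : Avg G k g)
    {v w : V} (hvw : v ≠ w) :
    ∀ (n : ℕ) (Z : Finset V), G.IsNClique (k + 1) Z → (∀ z ∈ Z, G.Adj v z) →
      (∀ z ∈ Z, G.Adj w z) → (∃ F : Finset V, (∀ x, x ∈ F ↔ x ∈ Z ∧ ¬ g x) ∧ #F = n) →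
      ∃ Z : Finset V, G.IsNClique (k + 1) Z ∧ (∀ z ∈ Z, G.Adj v z) ∧ (∀ z ∈ Z, G.Adj w z) ∧
        ∀ z ∈ Z, g z := by
  intro n
  induction n with
  | zero =>
    rintro Z hZ hv hw ⟨F, hF, hFn⟩
    refine ⟨Z, hZ, hv, hw, fun z hz => ?_⟩
    rw [Finset.card_eq_zero] at hFn
    subst hFn
    by_contra h
    have := (hF z).mpr ⟨hz, h⟩
    simp at this
  | succ n ih =>
    rintro Z hZ hv hw ⟨F, hF, hFn⟩
    obtain ⟨z, hzF⟩ : F.Nonempty := by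
      rw [← Finset.card_pos]; omega
    obtain ⟨hzZ, hzg⟩ := (hF z).mp hzF
    have hE : G.IsNClique k (Z.erase z) := by
      refine ⟨hZ.isClique.subset (by intro a ha; exact Finset.mem_of_mem_erase ha), ?_⟩
      rw [Finset.card_erase_of_mem hzZ, hZ.card_eq]
      omega
    have hEz : ∀ a ∈ Z.erase z, G.Adj z a := fun a ha =>
      hZ.isClique (Finset.mem_coe.mpr hzZ) (Finset.mem_coe.mpr (Finset.mem_of_mem_erase ha))
        (Finset.ne_of_mem_erase ha).symm
    have hEv : ∀ a ∈ Z.erase z, G.Adj v a := fun a ha => hv a (Finset.mem_of_mem_erase ha)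
    have hEw : ∀ a ∈ Z.erase z, G.Adj w a := fun a ha => hw a (Finset.mem_of_mem_erase ha)
    obtain ⟨x, hgx, hxA, hxB⟩ := hV (Z.erase z) {v, w, z} (by
      have := Finset.card_le_three (a := v) (b := w) (c := z)
      have := hE.card_eq
      omega) (by simp)
    have b1 := hxB v (by simp) w (by simp) hvw
    have b2 := hxB v (by simp) z (by simp) (hv z hzZ).ne
    have b3 := hxB w (by simp) z (by simp) (hw z hzZ).ne
    have hxz : ¬ G.Adj x z := by
      intro hxz
      rcases b1 with h | h
      · exact no_join hfree hE hxA hEv hEz h hxz (hv z hzZ)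
      · exact no_join hfree hE hxA hEw hEz h hxz (hw z hzZ)
    have hxv : G.Adj x v := by tauto
    have hxw : G.Adj x w := by tauto
    refine ih (insert x (Z.erase z)) (hE.insert hxA) ?_ ?_ ⟨F.erase z, ?_, ?_⟩
    · intro a ha
      rcases Finset.mem_insert.mp ha with rfl | ha
      · exact hxv.symm
      · exact hEv a ha
    · intro a ha
      rcases Finset.mem_insert.mp ha with rfl | ha
      · exact hxw.symm
      · exact hEw a ha
    · intro a
      simp only [Finset.mem_erase, Finset.mem_insert, hF]
      constructor
      · rintro ⟨h1, h2, h3⟩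
        exact ⟨Or.inr ⟨h1, h2⟩, h3⟩
      · rintro ⟨rfl | ⟨h1, h2⟩, h3⟩
        · exact absurd hgx h3
        · exact ⟨h1, h2, h3⟩
    · rw [Finset.card_erase_of_mem hzF, hFn]; rfl

/-- Similar vertices have nested neighbourhoods. -/
lemma sim_adj {k : ℕ} (hfree : G.CliqueFree (k + 3))
    (hmax : ∀ x y : V, x ≠ y → ¬ G.Adj x y → ¬ (G ⊔ SimpleGraph.edge x y).CliqueFree (k + 3))
    {g P : V → Prop} (hV : Avg G k g)
    (hgP : ∀ x, g x → P x) {u v : V} (hu : P u) (hs : Sim G k P u v) {w : V}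
    (huw : G.Adj u w) : G.Adj v w := by
  classical
  by_contra hvw
  have hna := sim_not_adj hfree hV hgP hu hs
  have hne : v ≠ w := by rintro rfl; exact hna huw
  obtain ⟨Z₀, h1, h2, h3⟩ := common_clique hfree hmax hne hvw
  obtain ⟨Z, hZ, hZv, hZw, hZg⟩ := good_clique hfree hV hne _ Z₀ h1 h2 h3
    ⟨Z₀.filter fun x => ¬ g x, by simp, rfl⟩
  have hK : G.IsNClique (k + 2) (insert w Z) := hZ.insert hZw
  obtain ⟨A, w', z, hA, hAw, hAz, hAu, hAv, hwz, huw', hvz, hgood⟩ :=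
    reduce hfree hV hna _ (insert w Z) hK (by
      intro x hx
      rcases Finset.mem_insert.mp hx with rfl | hx
      · exact Or.inl huw
      · exact Or.inr (hZv x hx))
      ⟨(insert w Z).filter fun x => ¬ (G.Adj u x ∧ G.Adj v x), by
        intro x; rw [Finset.mem_filter], rfl⟩
  have hgv : ∀ x ∈ insert w' (insert z A), G.Adj v x → P x := by
    intro x hx hvx
    rcases hgood x hx with h | h
    · rcases Finset.mem_insert.mp h with rfl | h
      · exact absurd hvx hvw
      · exact hgP _ (hZg x h)
    · exact hgP _ h
  have hPA : ∀ a ∈ A, P a := fun a ha => hgv a (by simp [ha]) (hAv a ha)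
  have hPz : P z := hgv z (by simp) hvz
  have huz : u ≠ z := by rintro rfl; exact hna hvz.symm
  obtain ⟨x, hgx, hxa, hxb⟩ := hV A {u, w', z} (by
      have := Finset.card_le_three (a := u) (b := w') (c := z)
      have := hA.card_eq
      omega) (by simp)
  have b1 := hxb u (by simp) w' (by simp) huw'.ne
  have b2 := hxb u (by simp) z (by simp) huz
  have b3 := hxb w' (by simp) z (by simp) hwz.ne
  by_cases hxw : G.Adj x w'
  · rcases b2 with h | h
    · exact no_join hfree hA hxa hAu hAw h hxw huw'
    · exact no_join hfree hA hxa hAw hAz hxw h hwz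
  · have hxu : G.Adj x u := by tauto
    have hxz : G.Adj x z := by tauto
    exact core hfree hu hs hna hA hPA (hgP x hgx) hPz hxz hxu.symm hvz hxa hAz hAu hAv

/-- From a finite colouring by twins to a blow-up. -/
lemma blowup_of_twins {C : Type} [Fintype C] (G : SimpleGraph V) (r : ℕ) (hr : 2 ≤ r)
    (hfree : G.CliqueFree r) (f : V → C)
    (hf : ∀ u v, f u = f v → ∀ w, G.Adj u w → G.Adj v w) :
    ∃ (H : SimpleGraph (Fin (Fintype.card C))) (f' : V → Fin (Fintype.card C)),
      H.CliqueFree r ∧ ∀ u v : V, G.Adj u v ↔ H.Adj (f' u) (f' v) := by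
  classical
  set F : V → Fin (Fintype.card C) := fun v => Fintype.equivFin C (f v) with hF
  have hFt : ∀ u v, F u = F v → ∀ w, G.Adj u w → G.Adj v w := by
    intro u v h
    exact hf u v ((Fintype.equivFin C).injective h)
  have hiff : ∀ u v a b, F u = F a → F v = F b → G.Adj u v → G.Adj a b := by
    intro u v a b h1 h2 h
    exact (hFt v b h2 a (hFt u a h1 v h).symm).symm
  let H : SimpleGraph (Fin (Fintype.card C)) :=
    { Adj := fun p q => ∃ u v, F u = p ∧ F v = q ∧ G.Adj u v
      symm := ⟨by
        rintro p q ⟨u, v, h1, h2, h3⟩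
        exact ⟨v, u, h2, h1, h3.symm⟩⟩
      loopless := ⟨by
        rintro p ⟨u, v, h1, h2, h3⟩
        exact G.loopless.irrefl v (hFt u v (h1.trans h2.symm) v h3)⟩ }
  refine ⟨H, F, ?_, ?_⟩
  · intro s hs
    have hrep : ∀ p ∈ s, ∃ u, F u = p := by
      intro p hp
      obtain ⟨q, hq, hqp⟩ := Finset.exists_mem_ne (s := s) (by rw [hs.card_eq]; omega) p
      obtain ⟨u, v, h1, h2, h3⟩ := hs.isClique (Finset.mem_coe.mpr hp) (Finset.mem_coe.mpr hq) hqp.symm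
      exact ⟨u, h1⟩
    have hVne : Nonempty V := by
      obtain ⟨p, hp⟩ : s.Nonempty := by rw [← Finset.card_pos, hs.card_eq]; omega
      exact ⟨(hrep p hp).choose⟩
    choose! rep hrep using hrep
    refine hfree (s.image rep) ⟨?_, ?_⟩
    · intro a ha b hb hab
      simp only [Finset.coe_image, Set.mem_image, Finset.mem_coe] at ha hb
      obtain ⟨p, hp, rfl⟩ := ha
      obtain ⟨q, hq, rfl⟩ := hb
      have hpq : p ≠ q := by rintro rfl; exact hab rfl
      obtain ⟨u, v, h1, h2, h3⟩ := hs.isClique (Finset.mem_coe.mpr hp) (Finset.mem_coe.mpr hq) hpq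
      exact hiff u v _ _ (h1.trans (hrep p hp).symm) (h2.trans (hrep q hq).symm) h3
    · rw [Finset.card_image_of_injOn, hs.card_eq]
      intro p hp q hq h
      rw [← hrep p hp, ← hrep q hq]
      exact congrArg F h
  · intro u v
    constructor
    · intro h
      exact ⟨u, v, rfl, rfl, h⟩
    · rintro ⟨a, b, h1, h2, h3⟩
      exact hiff a b u v h1 h2 h3

/-- Random sampling. -/
lemma sampling (G : SimpleGraph V) [DecidableRel G.Adj] (d ε : ℝ) (m : ℕ) (hd0 : 0 ≤ d)
    (hd1 : d ≤ 1) (hε : 0 < ε) (hε1 : ε ≤ 1) (hn : 0 < Fintype.card V)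
    (hm : 4 * Real.log (8 / ε) / ε ^ 2 ≤ m)
    (hdeg : ∀ v, (d + ε) * Fintype.card V ≤ G.degree v) :
    ∃ (X : Fin m → V), ∃ S : Finset V, (∀ v, v ∉ S → d * m < (#{i | G.Adj (X i) v} : ℝ)) ∧
      2 * (#S : ℝ) < ε * Fintype.card V := by
  classical
  set n : ℝ := ((Fintype.card V : ℕ) : ℝ) with hn'
  have hnpos : 0 < n := by rw [hn']; exact_mod_cast hn
  let S : (Fin m → V) → Finset V := fun X => {v | ¬ (d * m < (#{i | G.Adj (X i) v} : ℝ))}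
  by_contra hcon
  push Not at hcon
  have hS : ∀ X, ε * n ≤ 2 * (#(S X) : ℝ) := by
    intro X
    apply hcon X (S X)
    intro v hv
    simpa [S] using hv
  set t : ℝ := ε / 2 with ht
  let φ : V → V → ℝ := fun v x => Real.exp (t * (d - if G.Adj x v then 1 else 0))
  -- one step
  have hone : ∀ v, ∑ x, φ v x ≤ n * Real.exp (-(ε ^ 2 / 4)) := by
    intro v
    have hpt : ∀ x, φ v x ≤ 1 + t * (d - if G.Adj x v then 1 else 0) + t ^ 2 := by
      intro x
      have hb : |d - if G.Adj x v then (1 : ℝ) else 0| ≤ 1 := by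
        rw [abs_le]
        split_ifs <;> constructor <;> linarith
      have ht1 : |t| ≤ 1 := by rw [abs_le]; constructor <;> linarith
      have hy : |t * (d - if G.Adj x v then (1 : ℝ) else 0)| ≤ 1 := by
        rw [abs_mul]
        exact mul_le_one₀ ht1 (abs_nonneg _) hb
      have h1 := Real.abs_exp_sub_one_sub_id_le hy
      have h2 := (abs_le.mp h1).2
      have h3 : (t * (d - if G.Adj x v then (1 : ℝ) else 0)) ^ 2 ≤ t ^ 2 := by
        rw [mul_pow]
        have : (d - if G.Adj x v then (1 : ℝ) else 0) ^ 2 ≤ 1 := by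
          rw [← sq_abs]
          exact pow_le_one₀ (abs_nonneg _) hb
        exact mul_le_of_le_one_right (sq_nonneg t) this
      simp only [φ]
      linarith
    have hdegv : ∑ x, (if G.Adj x v then (1 : ℝ) else 0) = G.degree v := by
      rw [← G.card_neighborFinset_eq_degree, SimpleGraph.neighborFinset_eq_filter,
        Finset.card_filter]
      push_cast
      apply Finset.sum_congr rfl
      intro x _
      simp [G.adj_comm]
    calc ∑ x, φ v x ≤ ∑ x : V, (1 + t * (d - if G.Adj x v then 1 else 0) + t ^ 2) :=
          Finset.sum_le_sum fun x _ => hpt x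
      _ = n + t * (d * n - G.degree v) + t ^ 2 * n := by
          rw [Finset.sum_add_distrib, Finset.sum_add_distrib, ← Finset.mul_sum,
            Finset.sum_sub_distrib, hdegv]
          simp [← hn']
          ring
      _ ≤ n * (1 - ε ^ 2 / 4) := by
          have h := hdeg v
          have ht0 : 0 ≤ t := by positivity
          have := mul_le_mul_of_nonneg_left h ht0
          rw [ht] at *
          nlinarith
      _ ≤ _ := by
          have := Real.add_one_le_exp (-(ε ^ 2 / 4))
          apply mul_le_mul_of_nonneg_left _ hnpos.le
          linarith
  have hprod : ∀ v (X : Fin m → V),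
      ∏ i, φ v (X i) = Real.exp (t * (d * m - #{i | G.Adj (X i) v})) := by
    intro v X
    simp only [φ]
    rw [← Real.exp_sum, ← Finset.mul_sum, Finset.sum_sub_distrib, Finset.card_filter]
    push_cast
    simp
    left
    ring
  have hmem : ∀ X, (#(S X) : ℝ) ≤ ∑ v, ∏ i, φ v (X i) := by
    intro X
    rw [Finset.card_filter]
    push_cast
    apply Finset.sum_le_sum
    intro v _
    rw [hprod]
    split_ifs with h
    · exact (Real.exp_pos _).le
    · apply Real.one_le_exp
      apply mul_nonneg (by positivity)
      linarith
  have hcard : ((Fintype.card (Fin m → V) : ℕ) : ℝ) = n ^ m := by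
    simp [hn']
  have hlow : n ^ m * (ε * n) ≤ ∑ X : Fin m → V, 2 * (#(S X) : ℝ) := by
    rw [← hcard, ← nsmul_eq_mul]
    exact Finset.card_nsmul_le_sum _ _ _ fun X _ => hS X
  have hup : ∑ X : Fin m → V, 2 * (#(S X) : ℝ) ≤ 2 * (n * (n ^ m * (ε / 8))) := by
    rw [← Finset.mul_sum]
    apply mul_le_mul_of_nonneg_left _ (by norm_num)
    calc ∑ X : Fin m → V, (#(S X) : ℝ) ≤ ∑ X : Fin m → V, ∑ v, ∏ i, φ v (X i) :=
          Finset.sum_le_sum fun X _ => hmem X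
      _ = ∑ v, (∑ x, φ v x) ^ m := by
          rw [Finset.sum_comm]
          apply Finset.sum_congr rfl
          intro v _
          rw [Fintype.sum_pow]
      _ ≤ ∑ v : V, n ^ m * (ε / 8) := by
          apply Finset.sum_le_sum
          intro v _
          have h0 : 0 ≤ ∑ x, φ v x := Finset.sum_nonneg fun x _ => (Real.exp_pos _).le
          refine (pow_le_pow_left₀ h0 (hone v) m).trans ?_
          rw [mul_pow, ← Real.exp_nat_mul]
          apply mul_le_mul_of_nonneg_left _ (by positivity)
          rw [div_le_iff₀ (by positivity)] at hm
          have h8 : ε / 8 = Real.exp (- Real.log (8 / ε)) := by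
            rw [Real.exp_neg, Real.exp_log (by positivity), inv_div]
          rw [h8]
          apply Real.exp_le_exp.mpr
          linarith
      _ = _ := by simp [← hn']
  have : 0 < n ^ m * (ε * n) := by positivity
  nlinarith

end BlowupAux

/-- For `r ≥ 3`, `ε > 0`, `m = ⌈4 ln(8/ε)/ε²⌉ + 1`, `T = 2^m` and `L = 2^T + T`:
for every `n > L`, every maximal `K_r`-free graph `G` on `n` vertices with minimum
degree at least `((2r-5)/(2r-3) + ε) * n` is a blow-up of a `K_r`-free graph `H` on at
most `L` vertices, i.e. there is a map `f : V → Fin k`, `k ≤ L`, whose fibres partition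
`V` into independent sets, such that adjacency in `G` is given by adjacency in `H` of
the corresponding classes (so any two classes span a complete or empty bipartite graph). -/
theorem blowup_structure_of_maximal_cliquefree (r : ℕ) (hr : 3 ≤ r) (ε : ℝ) (hε : 0 < ε)
    (m T L : ℕ) (hm : m = ⌈4 * Real.log (8 / ε) / ε ^ 2⌉₊ + 1)
    (hT : T = 2 ^ m) (hL : L = 2 ^ T + T)
    (V : Type) [Fintype V] (hn : L < Fintype.card V)
    (G : SimpleGraph V) [DecidableRel G.Adj]
    (hfree : G.CliqueFree r)
    (hmax : ∀ x y : V, x ≠ y → ¬ G.Adj x y →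
      ¬ (G ⊔ SimpleGraph.edge x y).CliqueFree r)
    (hδ : ((2 * (r : ℝ) - 5) / (2 * (r : ℝ) - 3) + ε) * Fintype.card V ≤ G.minDegree) :
    ∃ (k : ℕ) (H : SimpleGraph (Fin k)) (f : V → Fin k),
      k ≤ L ∧ H.CliqueFree r ∧
      (∀ u v : V, G.Adj u v ↔ H.Adj (f u) (f v)) := by
  classical
  obtain ⟨k, rfl⟩ : ∃ k, r = k + 3 := ⟨r - 3, by omega⟩
  push_cast at hδ
  set d : ℝ := (2 * (k + 3 : ℝ) - 5) / (2 * (k + 3 : ℝ) - 3) with hd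
  have hn0 : 0 < Fintype.card V := by omega
  have hn0' : (0 : ℝ) < Fintype.card V := by exact_mod_cast hn0
  have hden : (0 : ℝ) < 2 * (k + 3 : ℝ) - 3 := by
    have : (0 : ℝ) ≤ k := by positivity
    linarith
  have hd0 : 0 ≤ d := by
    apply div_nonneg _ hden.le
    have : (0 : ℝ) ≤ k := by positivity
    linarith
  have hd1 : d ≤ 1 := by
    rw [hd, div_le_one hden]
    linarith
  have hdeg : ∀ v, (d + ε) * Fintype.card V ≤ G.degree v := by
    intro v
    refine hδ.trans ?_
    exact_mod_cast G.minDegree_le_degree v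
  have hε1 : ε ≤ 1 := by
    obtain ⟨v⟩ := Fintype.card_pos_iff.mp hn0
    have h1 := hdeg v
    have h2 : (G.degree v : ℝ) ≤ Fintype.card V := by
      exact_mod_cast (G.degree_lt_card_verts v).le
    have h3 : (d + ε) ≤ 1 := by
      by_contra h
      push Not at h
      nlinarith
    linarith
  have hmle : 4 * Real.log (8 / ε) / ε ^ 2 ≤ m := by
    rw [hm]
    push_cast
    have := Nat.le_ceil (4 * Real.log (8 / ε) / ε ^ 2)
    linarith
  obtain ⟨X, S, hX, hS⟩ := BlowupAux.sampling G d ε m hd0 hd1 hε hε1 hn0 hmle hdeg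
  have hV : BlowupAux.Avg G k (fun x => x ∉ S) := by
    intro A B hW hne
    refine BlowupAux.averaging (fun x a => G.Adj x a) S k d hd A B ?_ hW hne
    intro a _
    have h1 : Nat.card {i // G.Adj i a} = G.degree a := by
      rw [Nat.card_eq_fintype_card, Fintype.card_subtype, ← G.card_neighborFinset_eq_degree,
        SimpleGraph.neighborFinset_eq_filter]
      simp only [G.adj_comm]
    rw [h1]
    have := hdeg a
    linarith
  let tr : V → (Fin m → Bool) := fun v i => decide (G.Adj (X i) v)
  have hgood : ∀ u v, u ∉ S → tr u = tr v → ∀ w, G.Adj u w → G.Adj v w := by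
    intro u v hu htr w huw
    refine BlowupAux.sim_adj hfree hmax hV (P := fun x => x ∉ S) (fun _ h => h) hu ?_ huw
    intro A B hP hW hne
    obtain ⟨i, -, h1, h2⟩ := BlowupAux.averaging (I := Fin m) (fun i a => G.Adj (X i) a) ∅ k d hd A B
      (by
        intro a ha
        have := hX a (hP a ha)
        rw [Nat.card_eq_fintype_card, Fintype.card_subtype]
        simpa using this) hW hne
    refine ⟨X i, ?_, h1, h2⟩
    have := congrFun htr i
    simpa [tr] using this
  have hbad : ∀ u v, (∀ x, x ∉ S → (G.Adj x u ↔ G.Adj x v)) → ∀ w, G.Adj u w → G.Adj v w := by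
    intro u v huv w huw
    refine BlowupAux.sim_adj hfree hmax hV (P := fun _ => True) (fun _ _ => trivial) trivial ?_ huw
    intro A B _ hW hne
    obtain ⟨x, hx, h1, h2⟩ := hV A B hW hne
    exact ⟨x, huv x hx, h1, h2⟩
  let f : V → Finset (Fin m → Bool) ⊕ (Fin m → Bool) := fun v =>
    if v ∈ S then Sum.inl ((Finset.univ.filter fun x => x ∉ S ∧ G.Adj x v).image tr)
    else Sum.inr (tr v)
  have hf : ∀ u v, f u = f v → ∀ w, G.Adj u w → G.Adj v w := by
    intro u v huv
    simp only [f] at huv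
    by_cases hu : u ∈ S <;> by_cases hv : v ∈ S <;> simp only [hu, hv, if_true, if_false] at huv
    · have himg := Sum.inl_injective huv
      have half : ∀ a b : V,
          (Finset.univ.filter fun x => x ∉ S ∧ G.Adj x a).image tr =
          (Finset.univ.filter fun x => x ∉ S ∧ G.Adj x b).image tr →
          ∀ x, x ∉ S → G.Adj x a → G.Adj x b := by
        intro a b hab x hx hxa
        have h1 : tr x ∈ (Finset.univ.filter fun x => x ∉ S ∧ G.Adj x a).image tr :=
          Finset.mem_image_of_mem _ (by simp [hx, hxa])
        rw [hab] at h1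
        simp only [Finset.mem_image, Finset.mem_filter, Finset.mem_univ, true_and] at h1
        obtain ⟨y, ⟨hy, hyb⟩, hyx⟩ := h1
        exact hgood y x hy hyx b hyb
      exact hbad u v fun x hx => ⟨half u v himg x hx, half v u himg.symm x hx⟩
    · exact absurd huv (by simp)
    · exact absurd huv (by simp)
    · exact hgood u v hu (Sum.inr_injective huv)
  obtain ⟨H, f', h1, h2⟩ := BlowupAux.blowup_of_twins G (k + 3) (by omega) hfree f hf
  refine ⟨_, H, f', ?_, h1, h2⟩
  rw [hL, hT]
  simp
end

section
/- Let r ≥ 3, let ε > 0, and set m = ⌈4 ln(8/ε)/ε²⌉ + 1. Then every graph G = (V,E) on n ≥ m vertices with minimum degree δ(G) ≥ ((2r-5)/(2r-3) + ε)·n contains an m-element vertex set X ⊆ V such that the set U_X = { v ∈ V : |N(v) ∩ X| < ((2r-5)/(2r-3) + ε/2)·m } satisfies |U_X| ≤ ε·n/4 and |X ∩ U_X| < ε·m/4. -/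
open Finset

lemma aux_double {V : Type*} [DecidableEq V] (S : Finset V) (m : ℕ) (F : V → Finset V → ℝ) :
    ∑ X ∈ S.powersetCard (m+1), ∑ x ∈ X, F x X
      = ∑ x ∈ S, ∑ Y ∈ (S.erase x).powersetCard m, F x (insert x Y) := by
  rw [Finset.sum_sigma', Finset.sum_sigma']
  refine Finset.sum_bij' (fun a _ => ⟨a.2, a.1.erase a.2⟩) (fun b _ => ⟨insert b.1 b.2, b.1⟩) ?_ ?_ ?_ ?_ ?_
  · rintro ⟨X, x⟩ h
    simp only [mem_sigma, mem_powersetCard] at h ⊢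
    obtain ⟨⟨h1, h2⟩, h3⟩ := h
    refine ⟨h1 h3, erase_subset_erase _ h1, ?_⟩
    rw [card_erase_of_mem h3, h2]; rfl
  · rintro ⟨x, Y⟩ h
    simp only [mem_sigma, mem_powersetCard] at h ⊢
    obtain ⟨h1, h2, h3⟩ := h
    have hx : x ∉ Y := fun hx => by simpa using h2 hx
    refine ⟨⟨insert_subset h1 (h2.trans (erase_subset _ _)), ?_⟩, mem_insert_self _ _⟩
    rw [card_insert_of_notMem hx, h3]
  · rintro ⟨X, x⟩ h
    simp only [mem_sigma, mem_powersetCard] at h ⊢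
    simp [insert_erase h.2]
  · rintro ⟨x, Y⟩ h
    simp only [mem_sigma, mem_powersetCard] at h ⊢
    have hx : x ∉ Y := fun hx => by simpa using h.2.1 hx
    simp [erase_insert hx]
  · rintro ⟨X, x⟩ h
    simp only [mem_sigma, mem_powersetCard] at h ⊢
    simp [insert_erase h.2]

lemma aux_hoeff {V : Type*} (S : Finset V) (hS : S.Nonempty) (g : V → ℝ) (a t : ℝ) (ht : 0 ≤ t)
    (hg : ∀ x ∈ S, a ≤ g x ∧ g x ≤ a + t) :
    ∑ x ∈ S, Real.exp (g x) ≤ S.card * Real.exp ((∑ x ∈ S, g x) / S.card + t^2/8) := by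
  classical
  let : MeasurableSpace S := ⊤
  have : Nonempty S := hS.to_subtype
  have hc : (0:ℝ) < S.card := by exact_mod_cast hS.card_pos
  let μ := (PMF.uniformOfFintype S).toMeasure
  have hint : ∀ f : V → ℝ, ∫ x : S, f x ∂μ = (∑ x ∈ S, f x) / S.card := by
    intro f
    rw [PMF.integral_eq_sum, ← Finset.sum_coe_sort S, Finset.sum_div]
    refine Finset.sum_congr rfl fun x _ => ?_
    simp [div_eq_inv_mul]
  have h := (ProbabilityTheory.hasSubgaussianMGF_of_mem_Icc (μ := μ) (X := fun x : S => g x)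
    (a := a) (b := a + t) (measurable_from_top.aemeasurable)
    (Filter.Eventually.of_forall fun x => hg x x.2)).mgf_le 1
  rw [ProbabilityTheory.mgf, hint g] at h
  rw [hint (fun x => Real.exp (1 * (g x - (∑ x ∈ S, g x) / S.card)))] at h
  simp only [one_mul, Real.exp_sub, ← Finset.sum_div] at h
  rw [div_div, div_le_iff₀ (by positivity)] at h
  rw [Real.exp_add]
  refine h.trans (le_of_eq ?_)
  have : |t| = t := abs_of_nonneg ht
  simp only [add_sub_cancel_left, NNReal.coe_pow, NNReal.coe_div, coe_nnnorm, Real.norm_eq_abs, this, NNReal.coe_ofNat, one_pow, mul_one]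
  rw [show t^2/8 = (t/2)^2/2 by ring]
  ring

lemma aux_mgf {V : Type*} [DecidableEq V] (t : ℝ) (ht : 0 ≤ t) (m : ℕ) :
    ∀ (S N : Finset V), N ⊆ S → m ≤ S.card →
    ∑ X ∈ S.powersetCard m, Real.exp (-t * (N ∩ X).card)
      ≤ (S.card.choose m) * Real.exp (-t * m * N.card / S.card + m * t^2/8) := by
  induction m with
  | zero => intro S N _ _; simp
  | succ m ih =>
    intro S N hN hm
    have hS : S.Nonempty := card_pos.1 (by omega)
    obtain ⟨k, hk⟩ : ∃ k, S.card = k + 1 := ⟨S.card - 1, by omega⟩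
    have hmk : m ≤ k := by omega
    obtain ⟨d, hd⟩ : ∃ d : ℝ, d = (N.card : ℝ) := ⟨_, rfl⟩
    rw [← hd]
    let i : V → ℝ := fun x => if x ∈ N then 1 else 0
    have hi0 : ∀ x, i x = 0 ∨ i x = 1 := by
      intro x; by_cases h : x ∈ N <;> simp [i, h]
    let g : V → ℝ := fun x => -t * i x + -t * m * (d - i x) / k
    have hsumi : ∑ x ∈ S, i x = d := by
      simp [i, hd, Finset.inter_eq_right.2 hN]
    have key : ((m + 1 : ℕ) : ℝ) * ∑ X ∈ S.powersetCard (m+1), Real.exp (-t * (N ∩ X).card)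
        ≤ (k.choose m) * Real.exp (m * t^2/8) * ∑ x ∈ S, Real.exp (g x) := by
      have h1 : ((m + 1 : ℕ) : ℝ) * ∑ X ∈ S.powersetCard (m+1), Real.exp (-t * (N ∩ X).card)
          = ∑ X ∈ S.powersetCard (m+1), ∑ x ∈ X, Real.exp (-t * (N ∩ X).card) := by
        rw [Finset.mul_sum]
        refine Finset.sum_congr rfl fun X hX => ?_
        rw [Finset.sum_const, (mem_powersetCard.1 hX).2, nsmul_eq_mul]
      rw [h1, aux_double S m (fun _ X => Real.exp (-t * (N ∩ X).card)), Finset.mul_sum]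
      refine Finset.sum_le_sum fun x hx => ?_
      have hc : (S.erase x).card = k := by rw [card_erase_of_mem hx, hk]; rfl
      have := ih (S.erase x) (N.erase x) (erase_subset_erase _ hN) (by omega)
      have hNx : ((N.erase x).card : ℝ) = d - i x := by
        by_cases h : x ∈ N
        · have := card_erase_add_one h
          have h2 : ((N.erase x).card : ℝ) + 1 = d := by rw [hd]; exact_mod_cast this
          simp only [i, h, if_true]; linarith
        · simp [i, h, hd]
      rw [hc, hNx] at this
      have h2 : ∀ Y ∈ (S.erase x).powersetCard m, Real.exp (-t * (N ∩ insert x Y).card)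
          = Real.exp (-t * i x) * Real.exp (-t * (N.erase x ∩ Y).card) := by
        intro Y hY
        have hxY : x ∉ Y := fun h => by simpa using (mem_powersetCard.1 hY).1 h
        rw [← Real.exp_add]
        congr 1
        have : ((N ∩ insert x Y).card : ℝ) = i x + (N.erase x ∩ Y).card := by
          have e : N.erase x ∩ Y = N ∩ Y := by
            ext z; simp only [mem_inter, mem_erase]
            constructor
            · tauto
            · rintro ⟨a, b⟩; exact ⟨⟨fun h => hxY (h ▸ b), a⟩, b⟩
          rw [e]
          by_cases h : x ∈ N
          · rw [inter_insert_of_mem h, card_insert_of_notMem (by simp [hxY])]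
            simp [i, h]; ring
          · rw [inter_insert_of_notMem h]; simp [i, h]
        rw [this]; ring
      rw [Finset.sum_congr rfl h2, ← Finset.mul_sum]
      refine (mul_le_mul_of_nonneg_left this (Real.exp_pos _).le).trans (le_of_eq ?_)
      simp only [g, Real.exp_add]
      ring
    have hkm : (m : ℝ) / k ≤ 1 := by
      apply div_le_one_of_le₀ (by exact_mod_cast hmk) (by positivity)
    have hkm0 : (0 : ℝ) ≤ m / k := by positivity
    have hh := aux_hoeff S hS g (-t * m * d / k - t) t ht (by
      intro x _
      have e : g x = -t * m * d / k - t * i x * (1 - m / k) := by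
        simp only [g]; ring
      rw [e]
      rcases hi0 x with h | h <;> rw [h]
      · constructor <;> nlinarith
      · constructor <;> nlinarith)
    have hsum : (∑ x ∈ S, g x) / S.card = -t * (m+1 : ℕ) * d / S.card := by
      simp only [g]
      rw [Finset.sum_add_distrib, ← Finset.sum_div, ← Finset.mul_sum, ← Finset.mul_sum,
        Finset.sum_sub_distrib, hsumi, Finset.sum_const, nsmul_eq_mul, hk]
      rcases Nat.eq_zero_or_pos k with h0 | h0
      · have : m = 0 := by omega
        subst this; subst h0; simp
      · have : (0:ℝ) < k := by exact_mod_cast h0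
        push_cast
        field_simp
        ring
    rw [hsum] at hh
    have hch : (S.card : ℝ) * (k.choose m) = (S.card.choose (m+1)) * ((m+1 : ℕ) : ℝ) := by
      rw [hk]; exact_mod_cast Nat.add_one_mul_choose_eq k m
    have hpos : (0:ℝ) < ((m+1 : ℕ) : ℝ) := by positivity
    refine le_of_mul_le_mul_left (key.trans ?_) hpos
    refine (mul_le_mul_of_nonneg_left hh (by positivity)).trans (le_of_eq ?_)
    calc _ = ((S.card : ℝ) * (k.choose m)) * (Real.exp (m * t^2/8) * Real.exp (-t * (m+1 : ℕ) * d / S.card + t^2/8)) := by ring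
      _ = _ := by
        rw [hch, ← Real.exp_add]
        rw [show (m * t^2/8 + (-t * (m+1 : ℕ) * d / S.card + t^2/8) : ℝ) = -t * (m+1 : ℕ) * d / S.card + (m+1 : ℕ) * t^2/8 by push_cast; ring]
        ring

lemma aux_tail_s11 {V : Type*} [DecidableEq V] (t : ℝ) (ht : 0 ≤ t) (m : ℕ) (a : ℝ)
    (S N : Finset V) (hN : N ⊆ S) (hm : m ≤ S.card) :
    ∑ X ∈ S.powersetCard m, (if ((N ∩ X).card : ℝ) < a then (1:ℝ) else 0)
      ≤ (S.card.choose m) * Real.exp (t * a - t * m * N.card / S.card + m * t^2/8) := by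
  have h := mul_le_mul_of_nonneg_left (aux_mgf t ht m S N hN hm) (Real.exp_pos (t * a)).le
  rw [Finset.mul_sum] at h
  refine (Finset.sum_le_sum fun X _ => ?_).trans (h.trans (le_of_eq ?_))
  · split_ifs with hX
    · rw [← Real.exp_add]
      apply Real.one_le_exp
      nlinarith
    · positivity
  · rw [mul_left_comm, ← Real.exp_add]
    congr 2; ring

/-- For `r ≥ 3`, `ε > 0` and `m = ⌈4 ln(8/ε)/ε²⌉ + 1`, every graph on `n ≥ m` vertices with
minimum degree at least `((2r-5)/(2r-3)+ε)·n` contains an `m`-element vertex set `X` such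
that `U_X = {v : |N(v) ∩ X| < ((2r-5)/(2r-3)+ε/2)·m}` satisfies `|U_X| ≤ εn/4` and
`|X ∩ U_X| < εm/4`. -/
theorem good_random_set_exists (r : ℕ) (hr : 3 ≤ r) (ε : ℝ) (hε : 0 < ε)
    (m : ℕ) (hm : m = ⌈4 * Real.log (8 / ε) / ε ^ 2⌉₊ + 1)
    (V : Type) [Fintype V] (hn : m ≤ Fintype.card V)
    (G : SimpleGraph V) [DecidableRel G.Adj]
    (hδ : ((2 * (r : ℝ) - 5) / (2 * (r : ℝ) - 3) + ε) * Fintype.card V ≤ G.minDegree) :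
    ∃ X : Finset V, X.card = m ∧
      (({v : V | ((G.neighborSet v ∩ ↑X).ncard : ℝ) <
          ((2 * (r : ℝ) - 5) / (2 * (r : ℝ) - 3) + ε / 2) * m}.ncard : ℝ)
        ≤ ε * Fintype.card V / 4) ∧
      (((↑X ∩ {v : V | ((G.neighborSet v ∩ ↑X).ncard : ℝ) <
          ((2 * (r : ℝ) - 5) / (2 * (r : ℝ) - 3) + ε / 2) * m} : Set V).ncard : ℝ)
        < ε * m / 4) := by
  classical
  have hr' : (3:ℝ) ≤ r := by exact_mod_cast hr
  have hp : (1/3 : ℝ) ≤ (2 * (r : ℝ) - 5) / (2 * (r : ℝ) - 3) := by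
    rw [div_le_div_iff₀ (by norm_num) (by linarith)]; linarith
  generalize (2 * (r : ℝ) - 5) / (2 * (r : ℝ) - 3) = p at *
  set n := Fintype.card V with hnd
  obtain ⟨M, hM⟩ : ∃ M, M = ⌈4 * Real.log (8 / ε) / ε ^ 2⌉₊ := ⟨_, rfl⟩
  rw [← hM] at hm
  have hML : 4 * Real.log (8 / ε) ≤ M * ε^2 := by
    have := Nat.le_ceil (4 * Real.log (8 / ε) / ε ^ 2)
    rw [← hM] at this
    rwa [div_le_iff₀ (by positivity)] at this
  have hn0 : 0 < n := by omega
  have hn0' : (0:ℝ) < n := by exact_mod_cast hn0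
  have hm0' : (0:ℝ) < m := by rw [hm]; positivity
  have hmM : (m : ℝ) = M + 1 := by rw [hm]; push_cast; ring
  have hdeg : ∀ v, (p + ε) * n ≤ ((G.neighborFinset v).card : ℝ) := fun v =>
    hδ.trans (by exact_mod_cast G.minDegree_le_degree v)
  have hpe : p + ε < 1 := by
    obtain ⟨v⟩ : Nonempty V := Fintype.card_pos_iff.1 hn0
    have h1 : ((G.neighborFinset v).card : ℝ) < n := by exact_mod_cast G.degree_lt_card_verts v
    have := (hdeg v).trans_lt h1
    nlinarith
  have hε1 : ε < 2/3 := by linarith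
  -- the base exponential
  have hq : Real.exp (-(M * ε^2/2)) ≤ ε^2/64 := by
    calc Real.exp (-(M * ε^2/2)) ≤ Real.exp (-(Real.log (8/ε) + Real.log (8/ε))) :=
          Real.exp_le_exp.2 (by linarith)
      _ = ε^2/64 := by
          rw [Real.exp_neg, Real.exp_add, Real.exp_log (by positivity)]
          field_simp; norm_num
  have hq2 : Real.exp (2*ε) ≤ 8 := by
    calc Real.exp (2*ε) ≤ Real.exp (1 + 1) := Real.exp_le_exp.2 (by linarith)
      _ = Real.exp 1 * Real.exp 1 := Real.exp_add _ _
      _ ≤ 8 := by nlinarith [Real.exp_one_lt_d9, Real.exp_pos 1]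
  let b : V → Finset V → ℝ := fun v X =>
    if ((G.neighborFinset v ∩ X).card : ℝ) < (p + ε/2) * m then 1 else 0
  have hC : (0:ℝ) < n.choose m := by exact_mod_cast Nat.choose_pos hn
  have hU : (univ : Finset V).card = n := rfl
  have hcN : ∀ (X : Finset V) v, (G.neighborSet v ∩ ↑X).ncard = (G.neighborFinset v ∩ X).card := by
    intro X v
    rw [← Set.ncard_coe_finset]; simp
  -- first sum
  have hs1 : ∑ X ∈ (univ : Finset V).powersetCard m, ∑ v, b v X ≤ n * (n.choose m * (ε^2/64)) := by
    rw [Finset.sum_comm, ← hU, ← nsmul_eq_mul]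
    refine Finset.sum_le_card_nsmul _ _ _ fun v _ => ?_
    refine (aux_tail_s11 (2*ε) (by positivity) m _ univ (G.neighborFinset v) (subset_univ _) hn).trans ?_
    refine mul_le_mul_of_nonneg_left (le_trans (Real.exp_le_exp.2 ?_) hq) (by positivity)
    have h1 : (p + ε) ≤ (G.neighborFinset v).card / n := by
      rw [le_div_iff₀ hn0']; exact hdeg v
    rw [hU, mul_div_assoc]
    have h2 := mul_le_mul_of_nonneg_left h1 (by positivity : 0 ≤ 2 * ε * m)
    have h3 : (0:ℝ) ≤ ε^2 := by positivity
    rw [hmM] at *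
    nlinarith
  have hs2 : ∑ X ∈ (univ : Finset V).powersetCard m, ∑ v ∈ X, b v X
      ≤ m * (n.choose m * (ε^2/8)) := by
    have hch : (n : ℝ) * ((n-1).choose M) = (n.choose m) * (m : ℝ) := by
      obtain ⟨k, hk⟩ : ∃ k, n = k + 1 := ⟨n - 1, by omega⟩
      rw [hk, hm]; exact_mod_cast Nat.add_one_mul_choose_eq k M
    have : (m : ℝ) * (n.choose m * (ε^2/8)) = n * (((n-1).choose M) * (ε^2/8)) := by
      linear_combination (-(ε^2/8)) * hch
    rw [this, ← hU, ← nsmul_eq_mul, hm, aux_double]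
    refine Finset.sum_le_card_nsmul _ _ _ fun v _ => ?_
    have hce : ((univ : Finset V).erase v).card = n - 1 := by
      rw [card_erase_of_mem (mem_univ _)]; rfl
    have ht := aux_tail_s11 (2*ε) (by positivity) M ((p + ε/2) * m) (univ.erase v) (G.neighborFinset v)
      (by intro x hx; simp only [mem_erase, mem_univ, and_true]
          rintro rfl; simp at hx) (by omega)
    rw [hce] at ht
    have hb : ∀ Y, b v (insert v Y) =
        if ((G.neighborFinset v ∩ Y).card : ℝ) < (p + ε/2) * m then 1 else 0 := by
      intro Y
      simp only [b]
      rw [inter_insert_of_notMem (by simp)]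
    simp only [hb]
    refine ht.trans ?_
    rw [hU]
    refine mul_le_mul_of_nonneg_left ?_ (by positivity)
    have h0 : M * (p + ε) ≤ M * ((G.neighborFinset v).card / (n - 1 : ℕ)) := by
      rcases Nat.eq_zero_or_pos M with h | h
      · simp [h]
      · refine mul_le_mul_of_nonneg_left ?_ (by positivity)
        have h1 : (0:ℝ) < (n - 1 : ℕ) := by exact_mod_cast (by omega : 0 < n - 1)
        rw [le_div_iff₀ h1]
        refine le_trans (mul_le_mul_of_nonneg_left ?_ (by linarith)) (hdeg v)
        exact_mod_cast Nat.sub_le _ _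
    calc _ ≤ Real.exp (2*ε + -(M * ε^2/2)) := by
          refine Real.exp_le_exp.2 ?_
          rw [mul_div_assoc, mul_assoc (2*ε)]
          have h2 := mul_le_mul_of_nonneg_left h0 (by positivity : 0 ≤ 2 * ε)
          rw [hmM]
          nlinarith
      _ = Real.exp (2*ε) * Real.exp (-(M * ε^2/2)) := Real.exp_add _ _
      _ ≤ 8 * (ε^2/64) := mul_le_mul hq2 hq (Real.exp_pos _).le (by norm_num)
      _ = _ := by ring
  by_contra hcon
  push Not at hcon
  have hbad : ∀ X ∈ (univ : Finset V).powersetCard m,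
      (1:ℝ) ≤ (∑ v, b v X) / (ε * n / 4) + (∑ v ∈ X, b v X) / (ε * m / 4) := by
    intro X hX
    have h := hcon X (mem_powersetCard.1 hX).2
    simp only [hcN] at h
    have e1 : (({v : V | ((G.neighborFinset v ∩ X).card : ℝ) < (p + ε / 2) * m}.ncard : ℕ) : ℝ)
        = ∑ v, b v X := by
      simp only [b]
      rw [Finset.sum_boole, ← Set.ncard_coe_finset]
      simp
    have e2 : (((↑X ∩ {v : V | ((G.neighborFinset v ∩ X).card : ℝ) < (p + ε / 2) * m} : Set V).ncard : ℕ) : ℝ)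
        = ∑ v ∈ X, b v X := by
      simp only [b]
      rw [Finset.sum_boole, ← Set.ncard_coe_finset]
      congr 2
      ext; simp
    rw [e1, e2] at h
    have hb0 : ∀ v, 0 ≤ b v X := by
      intro v; simp only [b]; split_ifs <;> norm_num
    have p1 : 0 ≤ (∑ v, b v X) / (ε * n / 4) := by
      exact div_nonneg (Finset.sum_nonneg fun v _ => hb0 v) (by positivity)
    have p2 : 0 ≤ (∑ v ∈ X, b v X) / (ε * m / 4) := by
      exact div_nonneg (Finset.sum_nonneg fun v _ => hb0 v) (by positivity)
    by_cases h1 : ∑ v, b v X ≤ ε * n / 4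
    · have := (one_le_div (by positivity)).2 (h h1)
      linarith
    · have := (one_le_div (by positivity)).2 (not_le.1 h1).le
      linarith
  have hfin := Finset.sum_le_sum hbad
  rw [Finset.sum_add_distrib, ← Finset.sum_div, ← Finset.sum_div, Finset.sum_const,
    card_powersetCard, hU, nsmul_eq_mul, mul_one] at hfin
  have f1 : (∑ X ∈ (univ : Finset V).powersetCard m, ∑ v, b v X) / (ε * n / 4)
      ≤ n.choose m * (ε / 16) := by
    rw [div_le_iff₀ (by positivity)]
    refine hs1.trans (le_of_eq (by ring))
  have f2 : (∑ X ∈ (univ : Finset V).powersetCard m, ∑ v ∈ X, b v X) / (ε * m / 4)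
      ≤ n.choose m * (ε / 2) := by
    rw [div_le_iff₀ (by positivity)]
    refine hs2.trans (le_of_eq (by ring))
  nlinarith
end
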